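/- arXiv:2403.10260 — 8 statements merged into one kernel-verified Lean document; each statement's English description precedes it below -/
import Mathlib

section
/- Let A = A₀ + α₁ b₁c₁ᵀ + ⋯ + α_m b_m c_mᵀ be an n×n 1CM-matrix. Then the rank of A over K equals the minimum, over all subsets I ⊆ {1,…,m}, of the rank (over ℝ) of the real block matrix whose rows are indexed by {1,…,n} together with {1,…,m}∖I and whose columns are indexed by {1,…,n} together with I, given in block form by [[A₀, B[I]], [C[{1,…,m}∖I]ᵀ, O]]; here the top-left block is A₀, the top-right block has columns b_k for k ∈ I, the bottom-left block has rows c_kᵀ for k ∉ I, and the bottom-right block is zero. -/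
open Matrix MvPolynomial

noncomputable section

/-- The field `ℝ(α₁,…,α_m)` of rational functions over `ℝ` in `m` indeterminates. -/
abbrev Kf (m : ℕ) : Type := FractionRing (MvPolynomial (Fin m) ℝ)

/-- Canonical embedding of `ℝ` into `Kf m`. -/
def φ (m : ℕ) : ℝ →+* Kf m :=
  (algebraMap (MvPolynomial (Fin m) ℝ) (Kf m)).comp (MvPolynomial.C)

/-- The indeterminate `α_k` as an element of `Kf m`. -/
def α (m : ℕ) (k : Fin m) : Kf m :=
  algebraMap (MvPolynomial (Fin m) ℝ) (Kf m) (MvPolynomial.X k)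

/-- The 1CM-matrix `A = A₀ + α₁ b₁c₁ᵀ + ⋯ + α_m b_m c_mᵀ` over `Kf m`. -/
def oneCM (n m : ℕ) (A₀ : Matrix (Fin n) (Fin n) ℝ) (b c : Fin m → Fin n → ℝ) :
    Matrix (Fin n) (Fin n) (Kf m) :=
  A₀.map (φ m) + ∑ k : Fin m, α m k • (Matrix.vecMulVec (b k) (c k)).map (φ m)

namespace Matrix

/-- A full-rank factorization, with one-sided inverses of its factors. -/
theorem exists_full_rank_factorization {F p q : Type*} [Field F] [Fintype p] [Fintype q]
    [DecidableEq p] [DecidableEq q] (M : Matrix p q F) :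
    ∃ (P : Matrix p (Fin M.rank) F) (Q : Matrix (Fin M.rank) q F)
      (X : Matrix (Fin M.rank) p F) (Y : Matrix q (Fin M.rank) F),
      M = P * Q ∧ X * P = 1 ∧ Q * Y = 1 := by
  let g : LinearMap.range M.toLin' ≃ₗ[F] (Fin M.rank → F) :=
    LinearEquiv.ofFinrankEq _ _ (by rw [Module.finrank_fin_fun]; rfl)
  let P := (LinearMap.range M.toLin').subtype ∘ₗ g.symm.toLinearMap
  let Q := g.toLinearMap ∘ₗ M.toLin'.rangeRestrict
  obtain ⟨X, hX⟩ := LinearMap.exists_leftInverse_of_injective P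
    (LinearMap.ker_eq_bot.2 (Subtype.val_injective.comp g.symm.injective))
  obtain ⟨Y, hY⟩ := LinearMap.exists_rightInverse_of_surjective Q
    (LinearMap.range_eq_top.2 (g.surjective.comp M.toLin'.surjective_rangeRestrict))
  refine ⟨LinearMap.toMatrix' P, LinearMap.toMatrix' Q, LinearMap.toMatrix' X,
    LinearMap.toMatrix' Y, ?_, ?_, ?_⟩
  · rw [← LinearMap.toMatrix'_comp]
    have h : P ∘ₗ Q = M.toLin' := by
      refine LinearMap.ext fun x => ?_
      simp [P, Q]
    rw [h, LinearMap.toMatrix'_toLin']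
  · rw [← LinearMap.toMatrix'_comp, hX, LinearMap.toMatrix'_id]
  · rw [← LinearMap.toMatrix'_comp, hY, LinearMap.toMatrix'_id]

/-- The rank of a matrix does not change under a field extension. -/
theorem rank_map_ringHom {F L p q : Type*} [Field F] [Field L] [Fintype p] [Fintype q]
    (f : F →+* L) (M : Matrix p q F) : (M.map f).rank = M.rank := by
  classical
  obtain ⟨P, Q, X, Y, hM, hX, hY⟩ := M.exists_full_rank_factorization
  have hM' : M.map f = P.map f * Q.map f := by
    conv_lhs => rw [hM, Matrix.map_mul]
  have h1 : X.map f * M.map f * Y.map f = (1 : Matrix (Fin M.rank) (Fin M.rank) L) := by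
    rw [← Matrix.map_mul, ← Matrix.map_mul]
    have : X * M * Y = 1 := by
      calc X * M * Y = X * (P * Q) * Y := congrArg (X * · * Y) hM
        _ = (X * P) * (Q * Y) := by simp only [Matrix.mul_assoc]
        _ = 1 := by rw [hX, hY, Matrix.one_mul]
    rw [this]
    exact Matrix.map_one f f.map_zero f.map_one
  apply le_antisymm
  · rw [hM']
    exact (rank_mul_le_left _ _).trans ((rank_le_card_width _).trans_eq (Fintype.card_fin _))
  · have h2 := rank_one (R := L) (n := Fin M.rank)
    rw [← h1, Fintype.card_fin] at h2
    exact h2.symm.le.trans ((rank_mul_le_left _ _).trans (rank_mul_le_right _ _))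

/-- A vector either lies in the row space of a matrix or is separated from it by a vector of the
kernel. -/
theorem exists_vecMul_eq_or_exists_mulVec_eq_zero {F p q : Type*} [Field F] [Fintype p]
    [Fintype q] (M : Matrix p q F) (c : q → F) :
    (∃ v, v ᵥ* M = c) ∨ ∃ u, M *ᵥ u = 0 ∧ c ⬝ᵥ u = 1 := by
  classical
  by_cases hc : c ∈ LinearMap.range M.vecMulLinear
  · exact Or.inl hc
  right
  obtain ⟨f, hf, hle⟩ := Submodule.exists_le_ker_of_notMem hc
  have hdot (x : q → F) : f x = x ⬝ᵥ fun i => f (Pi.single i 1) := by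
    conv_lhs => rw [pi_eq_sum_univ' x]
    simp [dotProduct]
  refine ⟨(f c)⁻¹ • fun i => f (Pi.single i 1), ?_, ?_⟩
  · rw [mulVec_smul]
    convert smul_zero _
    ext i
    have h := hle ⟨Pi.single i 1, rfl⟩
    rw [LinearMap.mem_ker, hdot] at h
    simpa [mulVec, row_def] using h
  · rw [dotProduct_smul, ← hdot, smul_eq_mul, inv_mul_cancel₀ hf]

/-- A rank-one perturbation whose coefficient lies outside the subfield of the other entries
has rank at least that of one of the matrices obtained by freeing one of the two vectors. -/
theorem rank_add_vecMulVec_le_or {L p q : Type*} [Field L] [Fintype p] [Fintype q]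
    [DecidableEq p] [DecidableEq q] (E : Subfield L) (M : Matrix p q E) (b : p → E) (c : q → E)
    (a : L) (ha : a ∉ E) (e : q → L) (f : p → L) :
    (M.map E.subtype + vecMulVec (E.subtype ∘ b) e).rank ≤
        (M.map E.subtype + a • vecMulVec (E.subtype ∘ b) (E.subtype ∘ c)).rank ∨
      (M.map E.subtype + vecMulVec f (E.subtype ∘ c)).rank ≤
        (M.map E.subtype + a • vecMulVec (E.subtype ∘ b) (E.subtype ∘ c)).rank := by
  have ha0 : a ≠ 0 := fun h => ha (h ▸ E.zero_mem)
  obtain ⟨v, hv⟩ | ⟨u, hu, hcu⟩ := exists_vecMul_eq_or_exists_mulVec_eq_zero M c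
  · right
    set v' := E.subtype ∘ v
    set b' := E.subtype ∘ b
    have hc : E.subtype ∘ c = v' ᵥ* M.map E.subtype := by
      rw [← hv]
      ext i
      exact RingHom.map_vecMul E.subtype M v i
    have hdet : IsUnit (1 + vecMulVec (a • b') v').det := by
      rw [vecMulVec_eq Unit, det_one_add_replicateCol_mul_replicateRow, isUnit_iff_ne_zero,
        dotProduct_smul, smul_eq_mul]
      have hvb : v' ⬝ᵥ b' = ((v ⬝ᵥ b : E) : L) := (RingHom.map_dotProduct E.subtype v b).symm
      rw [hvb]
      intro h
      by_cases h0 : v ⬝ᵥ b = 0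
      · simp [h0] at h
      · have h0' : ((v ⬝ᵥ b : E) : L) ≠ 0 := by simpa using h0
        apply ha
        have : a = ((-(v ⬝ᵥ b)⁻¹ : E) : L) := by
          push_cast
          field_simp
          linear_combination h
        rw [this]
        exact SetLike.coe_mem _
    have hN : M.map E.subtype + a • vecMulVec b' (E.subtype ∘ c) =
        (1 + vecMulVec (a • b') v') * M.map E.subtype := by
      rw [Matrix.add_mul, Matrix.one_mul, vecMulVec_mul, hc, smul_vecMulVec]
    have hR : M.map E.subtype + vecMulVec f (E.subtype ∘ c) =
        (1 + vecMulVec f v') * M.map E.subtype := by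
      rw [Matrix.add_mul, Matrix.one_mul, vecMulVec_mul, hc]
    rw [hN, rank_mul_eq_right_of_isUnit_det _ _ hdet, hR]
    exact rank_mul_le_right _ _
  · left
    set u' := E.subtype ∘ u
    set b' := E.subtype ∘ b
    set c' := E.subtype ∘ c
    have hMu : M.map E.subtype *ᵥ u' = 0 := by
      ext i
      rw [← RingHom.map_mulVec E.subtype M u i, hu]
      simp
    have hcu' : c' ⬝ᵥ u' = 1 := by
      rw [← RingHom.map_dotProduct E.subtype c u, hcu, map_one]
    have hNu : (M.map E.subtype + a • vecMulVec b' c') *ᵥ u' = a • b' := by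
      rw [add_mulVec, hMu, zero_add, smul_mulVec, vecMulVec_mulVec, hcu']
      simp
    have key : M.map E.subtype + vecMulVec b' e =
        (M.map E.subtype + a • vecMulVec b' c') * (1 + vecMulVec u' (a⁻¹ • e - c')) := by
      rw [Matrix.mul_add, Matrix.mul_one, mul_vecMulVec, hNu]
      ext i j
      simp only [Matrix.add_apply, Matrix.smul_apply, vecMulVec_apply, Pi.smul_apply,
        Pi.sub_apply, smul_eq_mul]
      field_simp
      ring
    rw [key]
    exact rank_mul_le_left _ _

/-- For independent coefficients `a k`, some choice of freeing one vector in each rank-one term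
does not increase the rank. -/
theorem exists_rank_le_rank_add_sum {F L p q ι : Type*} [Field F] [Field L] [Algebra F L]
    [Fintype p] [Fintype q] [DecidableEq p] [DecidableEq q] [DecidableEq ι] (a : ι → L)
    (ha : ∀ (s : Set ι) (k : ι), k ∉ s → a k ∉ IntermediateField.adjoin F (a '' s))
    (b f : ι → p → F) (c e : ι → q → F) (S : Finset ι) (M : Matrix p q F) :
    ∃ I ⊆ S, (M + ∑ k ∈ I, vecMulVec (b k) (e k) + ∑ k ∈ S \ I, vecMulVec (f k) (c k)).rank ≤
      (M.map (algebraMap F L) +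
        ∑ k ∈ S, a k • (vecMulVec (b k) (c k)).map (algebraMap F L)).rank := by
  induction S using Finset.induction_on generalizing M with
  | empty => exact ⟨∅, subset_rfl, by simp [rank_map_ringHom]⟩
  | insert k S hk ih =>
    let E := IntermediateField.adjoin F (a '' S)
    have hF (x : F) : algebraMap F L x ∈ E.toSubfield := E.algebraMap_mem x
    have hmem (i : p) (j : q) : (M.map (algebraMap F L) +
        ∑ k ∈ S, a k • (vecMulVec (b k) (c k)).map (algebraMap F L)) i j ∈ E.toSubfield := by
      rw [Matrix.add_apply, Matrix.sum_apply]
      refine add_mem (hF _) (sum_mem fun l hl => mul_mem ?_ (hF _))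
      exact IntermediateField.subset_adjoin F _ ⟨l, hl, rfl⟩
    have hvec (x : p → F) (y : q → F) : (vecMulVec x y).map (algebraMap F L) =
        vecMulVec (algebraMap F L ∘ x) (algebraMap F L ∘ y) := by
      ext i j
      simp [vecMulVec_apply]
    have hstep := rank_add_vecMulVec_le_or E.toSubfield (Matrix.of fun i j => ⟨_, hmem i j⟩)
      (fun i => ⟨_, hF (b k i)⟩) (fun j => ⟨_, hF (c k j)⟩) (a k)
      (ha S k (by simpa using hk)) (algebraMap F L ∘ e k) (algebraMap F L ∘ f k)
    change (M.map (algebraMap F L) +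
          ∑ k ∈ S, a k • (vecMulVec (b k) (c k)).map (algebraMap F L) +
          vecMulVec (algebraMap F L ∘ b k) (algebraMap F L ∘ e k)).rank ≤
        (M.map (algebraMap F L) +
          ∑ k ∈ S, a k • (vecMulVec (b k) (c k)).map (algebraMap F L) +
          a k • vecMulVec (algebraMap F L ∘ b k) (algebraMap F L ∘ c k)).rank ∨
      (M.map (algebraMap F L) +
          ∑ k ∈ S, a k • (vecMulVec (b k) (c k)).map (algebraMap F L) +
          vecMulVec (algebraMap F L ∘ f k) (algebraMap F L ∘ c k)).rank ≤
        (M.map (algebraMap F L) +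
          ∑ k ∈ S, a k • (vecMulVec (b k) (c k)).map (algebraMap F L) +
          a k • vecMulVec (algebraMap F L ∘ b k) (algebraMap F L ∘ c k)).rank at hstep
    simp only [← hvec, add_assoc] at hstep
    rw [Finset.sum_insert hk, add_comm (a k • _)]
    have hadd (N : Matrix p q F) : (M + N).map (algebraMap F L) =
        M.map (algebraMap F L) + N.map (algebraMap F L) :=
      Matrix.map_add _ (map_add _) M N
    rcases hstep with h | h
    · obtain ⟨I, hI, hr⟩ := ih (M + vecMulVec (b k) (e k))
      have hkI : k ∉ I := fun h => hk (hI h)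
      refine ⟨insert k I, Finset.insert_subset_insert k hI, le_trans (le_of_eq ?_)
        (hr.trans (le_trans (le_of_eq ?_) h))⟩
      · rw [Finset.sum_insert hkI, Finset.insert_sdiff_insert, Finset.sdiff_insert,
          Finset.erase_eq_of_notMem (by simp [hk])]
        congr 1
        abel
      · rw [hadd, add_assoc, add_comm ((vecMulVec _ _).map _)]
    · obtain ⟨I, hI, hr⟩ := ih (M + vecMulVec (f k) (c k))
      have hkI : k ∉ I := fun h => hk (hI h)
      refine ⟨I, hI.trans (Finset.subset_insert k S), le_trans (le_of_eq ?_)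
        (hr.trans (le_trans (le_of_eq ?_) h))⟩
      · rw [Finset.insert_sdiff_of_notMem _ hkI, Finset.sum_insert (by simp [hk])]
        congr 1
        abel
      · rw [hadd, add_assoc, add_comm ((vecMulVec _ _).map _)]

end Matrix

/-- An indeterminate does not lie in the field generated by the others. -/
theorem α_notMem_adjoin (m : ℕ) (s : Set (Fin m)) (k : Fin m) (hk : k ∉ s) :
    α m k ∉ IntermediateField.adjoin ℝ (α m '' s) := by
  have hind : AlgebraicIndependent ℝ (α m) :=
    (MvPolynomial.algebraicIndependent_X (Fin m) ℝ).map'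
      (f := IsScalarTower.toAlgHom ℝ (MvPolynomial (Fin m) ℝ) (Kf m))
      (IsFractionRing.injective (MvPolynomial (Fin m) ℝ) (Kf m))
  intro h
  obtain ⟨x, hx, y, hy, hxy⟩ := IntermediateField.mem_adjoin_iff_div.1 h
  apply hind.transcendental_adjoin hk
  rw [hxy]
  exact (isAlgebraic_algebraMap (⟨x, hx⟩ : Algebra.adjoin ℝ (α m '' s))).mul
    (isAlgebraic_algebraMap (⟨y, hy⟩ : Algebra.adjoin ℝ (α m '' s))).inv

/-- The real block matrix `[[A₀, B[I]], [C[[m]∖I]ᵀ, O]]`. -/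
abbrev blockMatrix {n m : ℕ} (A₀ : Matrix (Fin n) (Fin n) ℝ) (b c : Fin m → Fin n → ℝ)
    (I : Finset (Fin m)) :
    Matrix (Fin n ⊕ {k : Fin m // k ∉ I}) (Fin n ⊕ {k : Fin m // k ∈ I}) ℝ :=
  Matrix.fromBlocks A₀ (Matrix.of fun i k => b k.1 i) (Matrix.of fun k j => c k.1 j) 0

theorem rank_oneCM_le_rank_blockMatrix {n m : ℕ} (A₀ : Matrix (Fin n) (Fin n) ℝ)
    (b c : Fin m → Fin n → ℝ) (I : Finset (Fin m)) :
    (oneCM n m A₀ b c).rank ≤ (blockMatrix A₀ b c I).rank := by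
  classical
  rw [← Matrix.rank_map_ringHom (φ m)]
  let P : Matrix (Fin n) (Fin n ⊕ {k : Fin m // k ∉ I}) (Kf m) :=
    Matrix.fromCols 1 (Matrix.of fun i k => α m k.1 * φ m (b k.1 i))
  let Q : Matrix (Fin n ⊕ {k : Fin m // k ∈ I}) (Fin n) (Kf m) :=
    Matrix.fromRows 1 (Matrix.of fun k j => α m k.1 * φ m (c k.1 j))
  have h : oneCM n m A₀ b c = P * (blockMatrix A₀ b c I).map (φ m) * Q := by
    rw [Matrix.fromBlocks_map, Matrix.fromCols_mul_fromBlocks, Matrix.fromCols_mul_fromRows]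
    ext i j
    simp only [oneCM, Matrix.add_apply, Matrix.sum_apply, Matrix.smul_apply, Matrix.map_apply,
      Matrix.vecMulVec_apply, smul_eq_mul, map_mul, Matrix.one_mul, Matrix.mul_one,
      Matrix.map_zero _ (map_zero _), Matrix.mul_zero, add_zero, Matrix.mul_apply,
      Matrix.of_apply]
    rw [← Fintype.sum_subtype_add_sum_subtype (fun k => k ∈ I), add_assoc]
    refine congrArg _ ((add_comm _ _).trans ?_)
    refine congrArg₂ _ ?_ ?_
    · exact Finset.sum_congr (by ext; simp) fun k _ => (mul_assoc _ _ _).symm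
    · exact Finset.sum_congr (by ext; simp) fun k _ => mul_left_comm _ _ _
  rw [h]
  exact (Matrix.rank_mul_le_left _ _).trans (Matrix.rank_mul_le_right _ _)

theorem exists_rank_blockMatrix_le_rank_oneCM {n m : ℕ} (A₀ : Matrix (Fin n) (Fin n) ℝ)
    (b c : Fin m → Fin n → ℝ) :
    ∃ I : Finset (Fin m), (blockMatrix A₀ b c I).rank ≤ (oneCM n m A₀ b c).rank := by
  classical
  obtain ⟨I, -, hI⟩ := Matrix.exists_rank_le_rank_add_sum (α m) (α_notMem_adjoin m)
    (fun k => (Sum.elim (b k) 0 : Fin n ⊕ Fin m → ℝ)) (fun k => Pi.single (Sum.inr k) 1)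
    (fun k => (Sum.elim (c k) 0 : Fin n ⊕ Fin m → ℝ)) (fun k => Pi.single (Sum.inr k) 1)
    Finset.univ (Matrix.fromBlocks A₀ 0 0 0)
  refine ⟨I, le_trans ?_ (hI.trans ?_)⟩
  · refine le_trans (le_of_eq (congrArg Matrix.rank ?_)) (Matrix.rank_submatrix_le _
      (Sum.map id Subtype.val) (Sum.map id Subtype.val))
    ext (i | i) (j | j)
    · simp [Matrix.sum_apply, Matrix.vecMulVec_apply]
    · simp [Matrix.sum_apply, Matrix.vecMulVec_apply, Pi.single_apply]
    · simp [Matrix.sum_apply, Matrix.vecMulVec_apply, Pi.single_apply, i.2]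
    · simp [Matrix.sum_apply, Matrix.vecMulVec_apply, Pi.single_apply]
  · let P : Matrix (Fin n ⊕ Fin m) (Fin n) (Kf m) := Matrix.fromRows 1 0
    let Q : Matrix (Fin n) (Fin n ⊕ Fin m) (Kf m) := Matrix.fromCols 1 0
    refine le_trans (le_of_eq (congrArg Matrix.rank (?_ : _ = P * oneCM n m A₀ b c * Q)))
      ((Matrix.rank_mul_le_left _ _).trans (Matrix.rank_mul_le_right _ _))
    rw [Matrix.fromRows_mul, Matrix.fromRows_mul_fromCols]
    have hφ (x : ℝ) : φ m x = algebraMap ℝ (Kf m) x := rfl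
    ext (i | i) (j | j) <;> simp [oneCM, Matrix.sum_apply, Matrix.vecMulVec_apply, hφ]



/-- The rank of a 1CM-matrix equals the minimum over subsets `I ⊆ [m]` of the rank of the
real block matrix `[[A₀, B[I]], [C[[m]∖I]ᵀ, O]]`. -/
theorem stmt_0 (n m : ℕ) (A₀ : Matrix (Fin n) (Fin n) ℝ) (b c : Fin m → Fin n → ℝ) :
    IsLeast
      {r : ℕ | ∃ I : Finset (Fin m),
        r = (Matrix.fromBlocks A₀
              (Matrix.of fun (i : Fin n) (k : {k : Fin m // k ∈ I}) => b k.1 i)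
              (Matrix.of fun (k : {k : Fin m // k ∉ I}) (j : Fin n) => c k.1 j)
              (0 : Matrix {k : Fin m // k ∉ I} {k : Fin m // k ∈ I} ℝ)).rank}
      (oneCM n m A₀ b c).rank := by
  obtain ⟨I, hI⟩ := exists_rank_blockMatrix_le_rank_oneCM A₀ b c
  refine ⟨⟨I, (rank_oneCM_le_rank_blockMatrix A₀ b c I).antisymm hI⟩, ?_⟩
  rintro _ ⟨J, rfl⟩
  exact rank_oneCM_le_rank_blockMatrix A₀ b c J

end
end

section
/- Let A = A₀ + α₁ b₁c₁ᵀ + ⋯ + α_m b_m c_mᵀ be an n×n 1CM-matrix, and let à be its sparse representation, namely the (n+m)×(n+m) matrix over K whose top-left n×n block is A₀, whose top-right n×m block is B, whose bottom-left m×n block is Cᵀ, and whose bottom-right m×m block is the diagonal matrix diag(α₁,…,α_m). Then rank A = rank à − m, both ranks taken over K. -/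
open Matrix MvPolynomial

noncomputable section

/-- The sparse representation `Ã = [[A₀, B], [Cᵀ, diag(α₁,…,α_m)]]` of a 1CM-matrix. -/
def sparseRep (n m : ℕ) (A₀ : Matrix (Fin n) (Fin n) ℝ) (b c : Fin m → Fin n → ℝ) :
    Matrix (Fin n ⊕ Fin m) (Fin n ⊕ Fin m) (Kf m) :=
  Matrix.fromBlocks
    (A₀.map (φ m))
    (Matrix.of fun (i : Fin n) (k : Fin m) => φ m (b k i))
    (Matrix.of fun (k : Fin m) (j : Fin n) => φ m (c k j))
    (Matrix.diagonal (α m))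

theorem Matrix.exists_mul_mul_eq_diagonal {K n : Type*} [Field K] [Fintype n] [DecidableEq n]
    (M : Matrix n n K) : ∃ (V U : Matrix n n K) (w : n → K),
      IsUnit V.det ∧ IsUnit U.det ∧ V * M * U = diagonal w := by
  obtain ⟨V, U, e, hV, hU, h⟩ := M.exists_rank_normal_form
  refine ⟨V, U, Sum.elim 1 0 ∘ e, (isUnit_iff_isUnit_det V).1 hV,
    (isUnit_iff_isUnit_det U).1 hU, ?_⟩
  rw [h, ← submatrix_diagonal_equiv]
  congr 1
  ext (i | i) (j | j) <;> simp [diagonal_apply, one_apply]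

theorem Matrix.rank_mul_mul_of_isUnit_det {K n : Type*} [Field K] [Fintype n] [DecidableEq n]
    {V U : Matrix n n K} (M : Matrix n n K) (hV : IsUnit V.det) (hU : IsUnit U.det) :
    (V * M * U).rank = M.rank := by
  rw [rank_mul_eq_left_of_isUnit_det _ _ hU, rank_mul_eq_right_of_isUnit_det _ _ hV]

theorem Matrix.rank_map_ringHom_s1 {K L n : Type*} [Field K] [Field L] [Fintype n] [DecidableEq n]
    (f : K →+* L) (M : Matrix n n K) : (M.map f).rank = M.rank := by
  classical
  obtain ⟨V, U, w, hV, hU, h⟩ := M.exists_mul_mul_eq_diagonal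
  have hdet {P : Matrix n n K} (hP : IsUnit P.det) : IsUnit (P.map f).det := by
    rw [← RingHom.mapMatrix_apply, ← RingHom.map_det]
    exact hP.map f
  rw [← rank_mul_mul_of_isUnit_det M hV hU, ← rank_mul_mul_of_isUnit_det _ (hdet hV) (hdet hU),
    ← Matrix.map_mul, ← Matrix.map_mul, h, diagonal_map (map_zero f), rank_diagonal, rank_diagonal]
  simp

theorem algebraicIndependent_α (m : ℕ) : AlgebraicIndependent ℝ (α m) :=
  (MvPolynomial.algebraicIndependent_X (Fin m) ℝ).map'
    (f := IsScalarTower.toAlgHom ℝ (MvPolynomial (Fin m) ℝ) (Kf m))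
    (IsFractionRing.injective (MvPolynomial (Fin m) ℝ) (Kf m))

theorem α_ne_zero (m : ℕ) (k : Fin m) : α m k ≠ 0 :=
  (algebraicIndependent_α m).ne_zero k

theorem algebraicIndependent_neg_inv_α (m : ℕ) :
    AlgebraicIndependent ℝ fun k => -(α m k)⁻¹ := by
  let S := Algebra.adjoin ℝ (Set.range fun k => -(α m k)⁻¹)
  have hα (k : Fin m) : IsAlgebraic S (α m k) := by
    have h : IsAlgebraic S (-(α m k)⁻¹) :=
      isAlgebraic_algebraMap (⟨_, Algebra.subset_adjoin ⟨k, rfl⟩⟩ : S)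
    simpa using h.neg.inv
  have hp (p : MvPolynomial (Fin m) ℝ) : IsAlgebraic S (algebraMap _ (Kf m) p) := by
    induction p using MvPolynomial.induction_on with
    | C r => exact isAlgebraic_algebraMap (algebraMap ℝ S r)
    | add p q hp hq => simpa using hp.add hq
    | mul_X p k hp => simpa [α] using hp.mul (hα k)
  have : Algebra.IsAlgebraic S (Kf m) := ⟨fun x => by
    obtain ⟨a, b, -, rfl⟩ := IsFractionRing.div_surjective (A := MvPolynomial (Fin m) ℝ) x
    rw [div_eq_mul_inv]
    exact (hp a).mul (hp b).inv⟩
  exact (Algebra.IsAlgebraic.isTranscendenceBasis_of_le_trdeg_of_finite ℝ _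
    (algebraicIndependent_α m).cardinalMk_le_trdeg).1

/-- The substitution `α_k ↦ -α_k⁻¹` is a field endomorphism of `Kf m` fixing `ℝ`. -/
theorem exists_ringHom_α_eq_neg_inv (m : ℕ) :
    ∃ σ : Kf m →+* Kf m, (∀ r, σ (φ m r) = φ m r) ∧ ∀ k, σ (α m k) = -(α m k)⁻¹ := by
  have h := algebraicIndependent_neg_inv_α m
  refine ⟨IsFractionRing.lift (g := (aeval fun k => -(α m k)⁻¹ : _ →ₐ[ℝ] Kf m).toRingHom) h,
    fun r => ?_, fun k => ?_⟩
  · simp [φ]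
    rfl
  · simp [α]

theorem Matrix.rank_fromBlocks_zero_zero {K l n : Type*} [Field K] [Fintype l] [DecidableEq l]
    [Fintype n] [DecidableEq n] (S : Matrix l l K) (D : Matrix n n K) (hD : IsUnit D.det) :
    (fromBlocks S 0 0 D).rank = S.rank + Fintype.card n := by
  classical
  obtain ⟨V, U, w, hV, hU, h⟩ := S.exists_mul_mul_eq_diagonal
  have key : fromBlocks V 0 0 D⁻¹ * fromBlocks S 0 0 D * fromBlocks U 0 0 1 =
      diagonal (Sum.elim w 1) := by
    simp [fromBlocks_multiply, h, nonsing_inv_mul _ hD, ← fromBlocks_diagonal]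
  rw [← rank_mul_mul_of_isUnit_det S hV hU, h,
    ← rank_mul_mul_of_isUnit_det (V := fromBlocks V 0 0 D⁻¹) (U := fromBlocks U 0 0 1) _
      (by simpa using ⟨hV.ne_zero, hD.ne_zero⟩) (by simpa using hU.ne_zero),
    key, rank_diagonal, rank_diagonal, Fintype.card_subtype, Fintype.card_subtype]
  simp only [Finset.card_filter, Fintype.sum_sum_type, Sum.elim_inl, Sum.elim_inr, Pi.one_apply,
    ne_eq, one_ne_zero, not_false_eq_true, if_true, Finset.sum_const, Finset.card_univ,
    smul_eq_mul, mul_one]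
  congr!

theorem Matrix.rank_fromBlocks_of_invertible₂₂ {K l n : Type*} [Field K] [Fintype l]
    [DecidableEq l] [Fintype n] [DecidableEq n] (A : Matrix l l K) (B : Matrix l n K)
    (C : Matrix n l K) (D : Matrix n n K) [Invertible D] :
    (fromBlocks A B C D).rank = (A - B * ⅟D * C).rank + Fintype.card n := by
  rw [fromBlocks_eq_of_invertible₂₂, rank_mul_eq_left_of_isUnit_det _ _ (by simp),
    rank_mul_eq_right_of_isUnit_det _ _ (by simp),
    rank_fromBlocks_zero_zero _ _ (isUnit_det_of_invertible D)]

/-- `rank A = rank Ã − m`, i.e. `rank Ã = rank A + m`, both ranks over `K`. -/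
theorem stmt_1 (n m : ℕ) (A₀ : Matrix (Fin n) (Fin n) ℝ) (b c : Fin m → Fin n → ℝ) :
    (sparseRep n m A₀ b c).rank = (oneCM n m A₀ b c).rank + m := by
  obtain ⟨σ, hφ, hα⟩ := exists_ringHom_α_eq_neg_inv m
  let : Invertible (diagonal (α m)) := ⟨diagonal fun k => (α m k)⁻¹, by
    simp [α_ne_zero], by simp [α_ne_zero]⟩
  rw [sparseRep, rank_fromBlocks_of_invertible₂₂, Fintype.card_fin,
    ← rank_map_ringHom_s1 σ (oneCM n m A₀ b c)]
  congr 2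
  ext i j
  have hinv : ⅟(diagonal (α m)) = diagonal fun k => (α m k)⁻¹ := rfl
  simp only [hinv, oneCM, Matrix.sub_apply, map_apply, of_apply, mul_apply (N := of _),
    mul_diagonal, Matrix.add_apply, Matrix.sum_apply, Matrix.smul_apply, vecMulVec_apply,
    smul_eq_mul, map_add, map_sum, map_mul, hφ, hα, sub_eq_add_neg, ← Finset.sum_neg_distrib]
  congr 1
  exact Finset.sum_congr rfl fun k _ => by ring

end
end

section
/- Let A = A₀ + α₁ b₁c₁ᵀ + ⋯ + α_m b_m c_mᵀ be an n×n 1CM-matrix that is singular, i.e., det A = 0 in K. Then there exists a vanishing pair of A: nonsingular real n×n matrices U and V such that for every permutation σ of {1,…,n} there exists an index i with (UAV)_{i,σ(i)} = 0. -/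
open Matrix MvPolynomial

noncomputable section

section MixedForm

variable {k κ : Type*} [Field k]

section Defs

variable {E F : Type*} [AddCommGroup E] [Module k E] [AddCommGroup F] [Module k F]

/-- The bilinear map `(x, y) ↦ a x y + ∑ j ∈ s, X j * (β j x * γ j y)` with values in polynomials. -/
def mixedForm (a : E →ₗ[k] F →ₗ[k] k) (β : κ → Module.Dual k E) (γ : κ → Module.Dual k F)
    (s : Finset κ) : E →ₗ[k] F →ₗ[k] MvPolynomial κ k :=
  LinearMap.mk₂ k (fun x y => C (a x y) + ∑ j ∈ s, X j * C (β j x * γ j y))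
    (fun x x' y => by
      simp only [map_add, LinearMap.add_apply, add_mul, mul_add, Finset.sum_add_distrib]; ring)
    (fun r x y => by
      simp only [map_smul, LinearMap.smul_apply, smul_eq_mul, map_mul, MvPolynomial.smul_eq_C_mul,
        mul_add, Finset.mul_sum]
      congr 1
      exact Finset.sum_congr rfl fun _ _ => by ring)
    (fun x y y' => by
      simp only [map_add, mul_add, Finset.sum_add_distrib]; ring)
    (fun r x y => by
      simp only [map_smul, smul_eq_mul, map_mul, MvPolynomial.smul_eq_C_mul,
        mul_add, Finset.mul_sum]
      congr 1
      exact Finset.sum_congr rfl fun _ _ => by ring)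

theorem mixedForm_apply (a : E →ₗ[k] F →ₗ[k] k) (β : κ → Module.Dual k E)
    (γ : κ → Module.Dual k F) (s : Finset κ) (x : E) (y : F) :
    mixedForm a β γ s x y = C (a x y) + ∑ j ∈ s, X j * C (β j x * γ j y) := rfl

theorem mixedForm_insert [DecidableEq κ] (a : E →ₗ[k] F →ₗ[k] k) (β : κ → Module.Dual k E)
    (γ : κ → Module.Dual k F) {s : Finset κ} {j : κ} (hj : j ∉ s) (x : E) (y : F) :
    mixedForm a β γ (insert j s) x y = mixedForm a β γ s x y + X j * C (β j x * γ j y) := by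
  rw [mixedForm_apply, mixedForm_apply, Finset.sum_insert hj]
  ring

/-- Substituting zero for a variable removes its term. -/
theorem det_mixedForm_of_insert [DecidableEq κ] {ι : Type*} [Fintype ι] [DecidableEq ι]
    (a : E →ₗ[k] F →ₗ[k] k) (β : κ → Module.Dual k E)
    (γ : κ → Module.Dual k F) {s : Finset κ} {j : κ} (hj : j ∉ s) (e : ι → E) (f : ι → F)
    (h : (Matrix.of fun i i' => mixedForm a β γ (insert j s) (e i) (f i')).det = 0) :
    (Matrix.of fun i i' => mixedForm a β γ s (e i) (f i')).det = 0 := by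
  set ρ : MvPolynomial κ k →ₐ[k] MvPolynomial κ k :=
    aeval fun l => if l = j then 0 else X l with hρ
  have h' := congrArg ρ h
  rw [map_zero, AlgHom.map_det] at h'
  convert h' using 2
  ext1 i i'
  simp only [AlgHom.mapMatrix_apply, Matrix.map_apply, Matrix.of_apply, mixedForm_insert _ _ _ hj,
    mixedForm_apply, map_add, map_sum, map_mul]
  have hC (r : k) : ρ (C r) = C r := ρ.commutes r
  have hX (l : κ) (hl : l ∈ s) : ρ (X l) = X l := by
    rw [hρ, aeval_X, if_neg]
    rintro rfl
    exact hj hl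
  have hX0 : ρ (X j) = 0 := by rw [hρ, aeval_X, if_pos rfl]
  rw [hX0, zero_mul, add_zero, hC]
  congr 1
  refine Finset.sum_congr rfl fun l hl => ?_
  rw [hX l hl, hC, hC]

/-- Vanishing of the determinant of a bilinear map does not depend on the choice of bases. -/
theorem det_bilin_eq_zero_of_basis {R ι ι' : Type*} [CommRing R] [Algebra k R]
    [Fintype ι] [DecidableEq ι] [Fintype ι'] [DecidableEq ι'] (A : E →ₗ[k] F →ₗ[k] R)
    (e : Module.Basis ι k E) (f : Module.Basis ι k F)
    (e' : Module.Basis ι' k E) (f' : Module.Basis ι' k F)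
    (h : (Matrix.of fun i j => A (e i) (f j)).det = 0) :
    (Matrix.of fun i j => A (e' i) (f' j)).det = 0 := by
  let σ : ι' ≃ ι := e'.indexEquiv e
  rw [← Matrix.det_submatrix_equiv_self σ.symm]
  have key : (Matrix.of fun i j => A (e' i) (f' j)).submatrix σ.symm σ.symm =
      ((e.toMatrix (e' ∘ σ.symm)).map (algebraMap k R))ᵀ * (Matrix.of fun i j => A (e i) (f j)) *
        (f.toMatrix (f' ∘ σ.symm)).map (algebraMap k R) := by
    ext i j
    simp only [Matrix.submatrix_apply, Matrix.of_apply, Matrix.mul_apply, Matrix.transpose_apply,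
      Matrix.map_apply, Module.Basis.toMatrix_apply, Function.comp_apply]
    conv_lhs => rw [← e.sum_repr (e' (σ.symm i)), ← f.sum_repr (f' (σ.symm j))]
    simp only [map_sum, map_smul, LinearMap.sum_apply, LinearMap.smul_apply, Algebra.smul_def,
      Finset.sum_mul, Finset.mul_sum]
    refine Finset.sum_congr rfl fun _ _ => Finset.sum_congr rfl fun _ _ => ?_
    ring
  rw [key, Matrix.det_mul, Matrix.det_mul, h, mul_zero, zero_mul]

theorem span_range_coe_basis {ι : Type*} {X : Submodule k E} (b : Module.Basis ι k X) :
    Submodule.span k (Set.range fun i => (b i : E)) = X := by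
  have h := congrArg (Submodule.map X.subtype) b.span_eq
  rwa [Submodule.map_span, Submodule.map_top, Submodule.range_subtype, ← Set.range_comp] at h

theorem linearIndependent_coe_basis {ι : Type*} {X : Submodule k E} (b : Module.Basis ι k X) :
    LinearIndependent k fun i => (b i : E) :=
  b.linearIndependent.map' X.subtype X.ker_subtype

/-- A basis adapted to a flag `X ⊓ ker β ≤ X` whose two steps are split by `x₀` and by a complement
`X'` of `X`. -/
theorem exists_basis_of_isCompl [FiniteDimensional k E] {ι ι' : Type*}
    {X X' : Submodule k E} (hX : IsCompl X X') (β : Module.Dual k E) {x₀ : E} (hx₀ : x₀ ∈ X)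
    (hβ : β x₀ ≠ 0) (b : Module.Basis ι k (X ⊓ LinearMap.ker β : Submodule k E))
    (b' : Module.Basis ι' k X') :
    ∃ e : Module.Basis (ι ⊕ (Unit ⊕ ι')) k E, (∀ i, e (.inl i) = b i) ∧
      e (.inr (.inl ())) = x₀ ∧ ∀ i, e (.inr (.inr i)) = b' i := by
  have hb : Submodule.span k (Set.range fun i => (b i : E)) = X ⊓ LinearMap.ker β :=
    span_range_coe_basis b
  have hb' : Submodule.span k (Set.range fun i => (b' i : E)) = X' :=
    span_range_coe_basis b'
  have hne : x₀ ≠ 0 := fun h => hβ (by rw [h, map_zero])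
  have hli : LinearIndependent k fun i => (b i : E) :=
    linearIndependent_coe_basis b
  have hli' : LinearIndependent k fun i => (b' i : E) :=
    linearIndependent_coe_basis b'
  have hx₀li : LinearIndependent k fun _ : Unit => x₀ := linearIndependent_unique_iff.2 hne
  have hsup : (X ⊓ LinearMap.ker β) ⊔ Submodule.span k {x₀} = X := by
    apply le_antisymm
    · exact sup_le inf_le_left ((Submodule.span_singleton_le_iff_mem _ _).2 hx₀)
    · intro x hx
      have hker : x - (β x / β x₀) • x₀ ∈ X ⊓ LinearMap.ker β := by
        refine Submodule.mem_inf.2 ⟨X.sub_mem hx (X.smul_mem _ hx₀), ?_⟩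
        rw [LinearMap.mem_ker, map_sub, map_smul, smul_eq_mul, div_mul_cancel₀ _ hβ, sub_self]
      have h := Submodule.add_mem_sup hker
        (Submodule.smul_mem _ (β x / β x₀) (Submodule.mem_span_singleton_self x₀))
      rwa [sub_add_cancel] at h
  have hdisj : Disjoint (Submodule.span k {x₀}) X' :=
    hX.disjoint.mono_left (by rwa [Submodule.span_singleton_le_iff_mem])
  have hd₁ : Disjoint (Submodule.span k (Set.range fun _ : Unit => x₀))
      (Submodule.span k (Set.range fun i => (b' i : E))) := by
    rwa [hb', Set.range_const]
  have h₁ := hx₀li.sum_type hli' hd₁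
  have hd₂ : Disjoint (Submodule.span k (Set.range fun i => (b i : E))) (Submodule.span k
      (Set.range (Sum.elim (fun _ : Unit => x₀) fun i => (b' i : E)))) := by
    rw [hb, Set.Sum.elim_range, Submodule.span_union, hb', Set.range_const]
    refine Disjoint.disjoint_sup_right_of_disjoint_sup_left ?_ (hsup.symm ▸ hX.disjoint)
    rw [Submodule.disjoint_span_singleton' hne]
    exact fun h => hβ h.2
  have h₂ := hli.sum_type h₁ hd₂
  have hspan : ⊤ ≤ Submodule.span k (Set.range (Sum.elim (fun i => (b i : E))
      (Sum.elim (fun _ : Unit => x₀) fun i => (b' i : E)))) := by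
    rw [Set.Sum.elim_range, Set.Sum.elim_range, Submodule.span_union, Submodule.span_union, hb,
      hb', Set.range_const, ← sup_assoc, hsup, hX.sup_eq_top]
  exact ⟨Module.Basis.mk h₂ hspan, fun i => Module.Basis.mk_apply h₂ hspan (.inl i),
    Module.Basis.mk_apply h₂ hspan (.inr (.inl ())),
    fun i => Module.Basis.mk_apply h₂ hspan (.inr (.inr i))⟩

theorem finrank_map_subtype_sup [FiniteDimensional k E] {X X' : Submodule k E} (hX : IsCompl X X')
    (Z : Submodule k X') :
    Module.finrank k (Z.map X'.subtype ⊔ X : Submodule k E) =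
      Module.finrank k Z + Module.finrank k X := by
  have h := Submodule.finrank_sup_add_finrank_inf_eq (Z.map X'.subtype) X
  rw [(hX.symm.disjoint.mono_left (Submodule.map_subtype_le X' Z)).eq_bot, finrank_bot,
    add_zero] at h
  rw [h, Submodule.finrank_map_subtype_eq]

theorem finrank_inf_ker [FiniteDimensional k E] (X : Submodule k E) (β : Module.Dual k E)
    {x₀ : E} (hx₀ : x₀ ∈ X) (hβ : β x₀ ≠ 0) :
    Module.finrank k (X ⊓ LinearMap.ker β : Submodule k E) + 1 = Module.finrank k X := by
  have h := Module.Dual.finrank_ker_add_one_of_ne_zero (f := β.domRestrict X)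
    (fun h => hβ (LinearMap.congr_fun h ⟨x₀, hx₀⟩))
  rw [← h, ← Submodule.finrank_map_subtype_eq X, LinearMap.ker_domRestrict,
    Submodule.map_comap_subtype]

end Defs

/-- A singular mixed form vanishes on a pair of subspaces whose dimensions add up to more than the
dimension of the ambient spaces. -/
theorem exists_submodule_mixedForm_eq_zero {E F ι : Type} [AddCommGroup E] [Module k E]
    [AddCommGroup F] [Module k F] [Fintype ι] [DecidableEq ι]
    (a : E →ₗ[k] F →ₗ[k] k) (β : κ → Module.Dual k E) (γ : κ → Module.Dual k F)
    (s : Finset κ) (e : Module.Basis ι k E) (f : Module.Basis ι k F)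
    (h : (Matrix.of fun i j => mixedForm a β γ s (e i) (f j)).det = 0) :
    ∃ (X : Submodule k E) (Y : Submodule k F),
      Fintype.card ι < Module.finrank k X + Module.finrank k Y ∧
      ∀ x ∈ X, ∀ y ∈ Y, mixedForm a β γ s x y = 0 := by
  classical
  induction s using Finset.induction_on generalizing E F ι with
  | empty =>
    have : FiniteDimensional k E := e.finiteDimensional_of_finite
    have : FiniteDimensional k F := f.finiteDimensional_of_finite
    have h0 : (Matrix.of fun i j => a (e i) (f j)).det = 0 := by
      apply MvPolynomial.C_injective κ k
      rw [map_zero, RingHom.map_det, ← h]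
      congr 1
      ext1 i j
      simp [mixedForm_apply]
    obtain ⟨v, hv, hMv⟩ := Matrix.exists_mulVec_eq_zero_iff.2 h0
    have hy : ∑ j, v j • f j ≠ 0 := fun h0 =>
      hv (funext fun j => Fintype.linearIndependent_iff.1 f.linearIndependent v h0 j)
    refine ⟨⊤, Submodule.span k {∑ j, v j • f j}, ?_, ?_⟩
    · rw [finrank_top, finrank_span_singleton hy, Module.finrank_eq_card_basis e]
      exact Nat.lt_succ_self _
    · intro x _ y hy
      obtain ⟨r, rfl⟩ := Submodule.mem_span_singleton.1 hy
      have hz : a.flip (∑ j, v j • f j) = 0 := by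
        refine e.ext fun i => ?_
        have := congrFun hMv i
        simpa [Matrix.mulVec, dotProduct, mul_comm] using this
      have hz' : a x (∑ j, v j • f j) = 0 := LinearMap.congr_fun hz x
      rw [mixedForm_apply, Finset.sum_empty, add_zero, map_smul, hz', smul_zero, C_0]
  | insert j s hj ih =>
    have : FiniteDimensional k E := e.finiteDimensional_of_finite
    have : FiniteDimensional k F := f.finiteDimensional_of_finite
    obtain ⟨X, Y, hXY, hA⟩ := ih a β γ e f (det_mixedForm_of_insert a β γ hj e f h)
    have hvanish {x : E} {y : F} (hs : mixedForm a β γ s x y = 0)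
        (hor : β j x = 0 ∨ γ j y = 0) : mixedForm a β γ (insert j s) x y = 0 := by
      rw [mixedForm_insert _ _ _ hj, hs, zero_add, mul_eq_zero.2 hor, C_0, mul_zero]
    by_cases hβ : ∀ x ∈ X, β j x = 0
    · exact ⟨X, Y, hXY, fun x hx y hy => hvanish (hA x hx y hy) (.inl (hβ x hx))⟩
    by_cases hγ : ∀ y ∈ Y, γ j y = 0
    · exact ⟨X, Y, hXY, fun x hx y hy => hvanish (hA x hx y hy) (.inr (hγ y hy))⟩
    push Not at hβ hγ
    obtain ⟨x₀, hx₀, hβ⟩ := hβ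
    obtain ⟨y₀, hy₀, hγ⟩ := hγ
    have hX₁ := finrank_inf_ker X (β j) hx₀ hβ
    have hY₁ := finrank_inf_ker Y (γ j) hy₀ hγ
    by_cases hgt : Fintype.card ι + 1 < Module.finrank k X + Module.finrank k Y
    · exact ⟨X ⊓ LinearMap.ker (β j), Y, by omega,
        fun x hx y hy => hvanish (hA x hx.1 y hy) (.inl hx.2)⟩
    obtain ⟨X', hX'⟩ := X.exists_isCompl
    obtain ⟨Y', hY'⟩ := Y.exists_isCompl
    have hXX' := Submodule.finrank_add_eq_of_isCompl hX'
    have hYY' := Submodule.finrank_add_eq_of_isCompl hY'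
    rw [Module.finrank_eq_card_basis e] at hXX'
    rw [Module.finrank_eq_card_basis f] at hYY'
    let bX := Module.finBasis k (X ⊓ LinearMap.ker (β j) : Submodule k E)
    let bX' := Module.finBasis k X'
    let bY := Module.finBasisOfFinrankEq k (Y ⊓ LinearMap.ker (γ j) : Submodule k F)
      (n := Module.finrank k X') (by omega)
    let bY' := Module.finBasisOfFinrankEq k Y'
      (n := Module.finrank k (X ⊓ LinearMap.ker (β j) : Submodule k E)) (by omega)
    obtain ⟨e', he₁, he₂, he₃⟩ := exists_basis_of_isCompl hX' (β j) hx₀ hβ bX bX'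
    obtain ⟨f₀, hf₁, hf₂, hf₃⟩ := exists_basis_of_isCompl hY' (γ j) hy₀ hγ bY bY'
    let f' := f₀.reindex ((Equiv.sumAssoc _ _ _).symm.trans
      ((Equiv.sumComm _ _).trans (Equiv.sumCongr (Equiv.refl _) (Equiv.sumComm _ _))))
    have hf₁' (i) : f' (.inr (.inr i)) = bY i := by rw [← hf₁]; simp [f']
    have hf₂' : f' (.inr (.inl ())) = y₀ := by rw [← hf₂]; simp [f']
    have hf₃' (i) : f' (.inl i) = bY' i := by rw [← hf₃]; simp [f']
    have hdet := det_bilin_eq_zero_of_basis _ e f e' f' h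
    set M := Matrix.of fun i i' => mixedForm a β γ (insert j s) (e' i) (f' i')
    have hM₁₂ : M.toBlocks₁₂ = 0 := by
      ext1 i i'
      change mixedForm a β γ (insert j s) (e' (.inl i)) (f' (.inr i')) = 0
      rw [he₁]
      refine hvanish (hA _ (bX i).2.1 _ ?_) (.inl (bX i).2.2)
      rcases i' with _ | i'
      · rwa [hf₂']
      · rw [hf₁']
        exact (bY i').2.1
    have hN₁₂ : M.toBlocks₂₂.toBlocks₁₂ = 0 := by
      ext1 i i'
      change mixedForm a β γ (insert j s) (e' (.inr (.inl ()))) (f' (.inr (.inr i'))) = 0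
      rw [he₂, hf₁']
      exact hvanish (hA _ hx₀ _ (bY i').2.1) (.inr (bY i').2.2)
    have hN₁₁ : M.toBlocks₂₂.toBlocks₁₁.det ≠ 0 := by
      rw [Matrix.det_unique]
      change mixedForm a β γ (insert j s) (e' (.inr (.inl ()))) (f' (.inr (.inl ()))) ≠ 0
      rw [he₂, hf₂', mixedForm_insert _ _ _ hj, hA _ hx₀ _ hy₀, zero_add]
      exact mul_ne_zero (X_ne_zero j) (C_ne_zero.2 (mul_ne_zero hβ hγ))
    rw [← M.fromBlocks_toBlocks, hM₁₂, Matrix.det_fromBlocks_zero₁₂,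
      ← M.toBlocks₂₂.fromBlocks_toBlocks, hN₁₂, Matrix.det_fromBlocks_zero₁₂,
      mul_eq_zero, mul_eq_zero] at hdet
    rcases hdet with hdet | hdet | hdet
    · obtain ⟨X'', Y'', hcard, hZ⟩ := ih
        (a.domRestrict₁₂ (X ⊓ LinearMap.ker (β j)) Y')
        (fun l => (β l).domRestrict _) (fun l => (γ l).domRestrict _) bX bY' (by
          rw [← hdet]
          congr 1
          ext1 i i'
          change mixedForm a β γ s (bX i : E) (bY' i' : F) =
            mixedForm a β γ (insert j s) (e' (.inl i)) (f' (.inl i'))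
          have hb : β j (bX i) = 0 := (bX i).2.2
          rw [he₁, hf₃', mixedForm_insert _ _ _ hj, hb, zero_mul, C_0, mul_zero, add_zero])
      refine ⟨X''.map (Submodule.subtype _), Y''.map Y'.subtype ⊔ Y, ?_, ?_⟩
      · rw [finrank_map_subtype_sup hY', Submodule.finrank_map_subtype_eq]
        rw [Fintype.card_fin] at hcard
        omega
      · rintro _ ⟨x, hx, rfl⟩ y hy
        obtain ⟨_, ⟨y', hy', rfl⟩, y, hyY, rfl⟩ := Submodule.mem_sup.1 hy
        refine hvanish ?_ (.inl x.2.2)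
        rw [map_add]
        exact (congrArg₂ (· + ·) (hZ x hx y' hy') (hA _ x.2.1 _ hyY)).trans (add_zero _)
    · exact absurd hdet hN₁₁
    · obtain ⟨X'', Y'', hcard, hZ⟩ := ih
        (a.domRestrict₁₂ X' (Y ⊓ LinearMap.ker (γ j)))
        (fun l => (β l).domRestrict _) (fun l => (γ l).domRestrict _) bX' bY (by
          rw [← hdet]
          congr 1
          ext1 i i'
          change mixedForm a β γ s (bX' i : E) (bY i' : F) =
            mixedForm a β γ (insert j s) (e' (.inr (.inr i))) (f' (.inr (.inr i')))
          have hb : γ j (bY i') = 0 := (bY i').2.2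
          rw [he₃, hf₁', mixedForm_insert _ _ _ hj, hb, mul_zero, C_0, mul_zero, add_zero])
      refine ⟨X''.map X'.subtype ⊔ X, Y''.map (Submodule.subtype _), ?_, ?_⟩
      · rw [finrank_map_subtype_sup hX', Submodule.finrank_map_subtype_eq]
        rw [Fintype.card_fin] at hcard
        omega
      · rintro x hx _ ⟨y, hy, rfl⟩
        obtain ⟨_, ⟨x', hx', rfl⟩, x, hxX, rfl⟩ := Submodule.mem_sup.1 hx
        refine hvanish ?_ (.inr y.2.2)
        rw [map_add]
        exact (congrArg₂ (· + ·) (hZ x' hx' y hy) (hA _ hxX _ y.2.1)).trans (add_zero _)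

/-- Every subspace of `kⁿ` contains as many members of some basis as its dimension. -/
theorem exists_basis_card_eq_finrank {n : ℕ} (X : Submodule k (Fin n → k)) :
    ∃ (e : Module.Basis (Fin n) k (Fin n → k)) (S : Finset (Fin n)),
      (∀ i ∈ S, e i ∈ X) ∧ S.card = Module.finrank k X := by
  obtain ⟨X', hX'⟩ := X.exists_isCompl
  let e₀ := ((Module.finBasis k X).prod (Module.finBasis k X')).map
    (Submodule.prodEquivOfIsCompl X X' hX')
  let σ := e₀.indexEquiv (Pi.basisFun k (Fin n))
  refine ⟨e₀.reindex σ, Finset.univ.map (Function.Embedding.inl.trans σ.toEmbedding), ?_, by simp⟩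
  intro i hi
  obtain ⟨l, -, rfl⟩ := Finset.mem_map.1 hi
  simp [e₀]

theorem det_of_basis_ne_zero {n : ℕ} (e : Module.Basis (Fin n) k (Fin n → k)) :
    (Matrix.of fun i j => e i j).det ≠ 0 := by
  have h := (Pi.basisFun k (Fin n)).isUnit_det e
  rw [Module.Basis.det_apply] at h
  rw [← Matrix.det_transpose]
  exact h.ne_zero

end MixedForm

/-- The bilinear form `xᵀ A y` of a 1CM-matrix, evaluated at real vectors. -/
theorem oneCM_mul_apply (n m : ℕ) (A₀ : Matrix (Fin n) (Fin n) ℝ) (b c : Fin m → Fin n → ℝ)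
    (U V : Matrix (Fin n) (Fin n) ℝ) (i j : Fin n) :
    (U.map (φ m) * oneCM n m A₀ b c * V.map (φ m)) i j =
      algebraMap (MvPolynomial (Fin m) ℝ) (Kf m)
        (mixedForm (Matrix.toLinearMap₂' ℝ A₀) (fun l => dotProductBilin ℝ ℝ (b l))
          (fun l => dotProductBilin ℝ ℝ (c l)) Finset.univ (U i) (Vᵀ j)) := by
  have hmul (M : Matrix (Fin n) (Fin n) ℝ) :
      U.map (φ m) * M.map (φ m) * V.map (φ m) = (U * M * V).map (φ m) := by
    rw [Matrix.map_mul, Matrix.map_mul]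
  rw [oneCM, mul_add, add_mul, hmul, Finset.mul_sum, Finset.sum_mul, Matrix.add_apply,
    Matrix.sum_apply, mixedForm_apply, map_add, map_sum]
  congr 1
  · rw [Matrix.map_apply, Matrix.toLinearMap₂'_apply', Matrix.mul_assoc, Matrix.mul_apply']
    rfl
  · refine Finset.sum_congr rfl fun l _ => ?_
    rw [Matrix.mul_smul, Matrix.smul_mul, hmul, Matrix.smul_apply, Matrix.map_apply,
      Matrix.mul_vecMulVec, Matrix.vecMulVec_mul, Matrix.vecMulVec_apply, smul_eq_mul,
      map_mul (algebraMap _ _), show dotProductBilin ℝ ℝ (b l) (U i) = (U *ᵥ b l) i from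
        dotProduct_comm (b l) (U i)]
    rfl

/-- A singular 1CM-matrix admits a vanishing pair: nonsingular real matrices `U, V` such that
`UAV` has term-rank less than `n`, i.e., every permutation misses a zero entry of `UAV`. -/
theorem stmt_3 (n m : ℕ) (A₀ : Matrix (Fin n) (Fin n) ℝ) (b c : Fin m → Fin n → ℝ)
    (hsing : (oneCM n m A₀ b c).det = 0) :
    ∃ U V : Matrix (Fin n) (Fin n) ℝ, U.det ≠ 0 ∧ V.det ≠ 0 ∧
      ∀ σ : Equiv.Perm (Fin n),
        ∃ i : Fin n, (U.map (φ m) * oneCM n m A₀ b c * V.map (φ m)) i (σ i) = 0 := by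
  have hdet : (Matrix.of fun i j => mixedForm (Matrix.toLinearMap₂' ℝ A₀)
      (fun l => dotProductBilin ℝ ℝ (b l)) (fun l => dotProductBilin ℝ ℝ (c l)) Finset.univ
      (Pi.basisFun ℝ (Fin n) i) (Pi.basisFun ℝ (Fin n) j)).det = 0 := by
    apply IsFractionRing.injective (MvPolynomial (Fin m) ℝ) (Kf m)
    rw [map_zero, RingHom.map_det, ← hsing]
    congr 1
    ext1 i j
    have h := oneCM_mul_apply n m A₀ b c 1 1 i j
    rw [Matrix.map_one _ (map_zero _) (map_one _), one_mul, mul_one] at h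
    rw [h, RingHom.mapMatrix_apply, Matrix.map_apply, Matrix.of_apply]
    congr 3 <;> ext l <;> simp [Matrix.one_apply, Pi.single_apply, eq_comm]
  obtain ⟨X, Y, hXY, hA⟩ := exists_submodule_mixedForm_eq_zero _ _ _ _ _ _ hdet
  obtain ⟨e, S, heS, hS⟩ := exists_basis_card_eq_finrank X
  obtain ⟨f, T, hfT, hT⟩ := exists_basis_card_eq_finrank Y
  refine ⟨Matrix.of fun i j => e i j, (Matrix.of fun i j => f i j)ᵀ, det_of_basis_ne_zero e,
    by rw [Matrix.det_transpose]; exact det_of_basis_ne_zero f, fun σ => ?_⟩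
  have hST : (S ∩ T.map σ.symm.toEmbedding).Nonempty := by
    apply Finset.inter_nonempty_of_card_lt_card_add_card (Finset.subset_univ _)
      (Finset.subset_univ _)
    rwa [Finset.card_map, hS, hT, Finset.card_univ]
  obtain ⟨i, hi⟩ := hST
  rw [Finset.mem_inter, Finset.mem_map_equiv, Equiv.symm_symm] at hi
  refine ⟨i, ?_⟩
  rw [oneCM_mul_apply]
  exact (congrArg _ (hA _ (heS i hi.1) _ (hfT _ hi.2))).trans (map_zero _)

end
end

section
/- Let A = A₀ + α₁ b₁c₁ᵀ + ⋯ + α_m b_m c_mᵀ be an n×n 1CM-matrix with rank r over K, where r < n. Then there exist nonsingular real n×n matrices U and V and subsets S, T ⊆ {1,…,n} with |S| + |T| ≥ 2n − r such that the submatrix of UAV with rows S and columns T is identically zero, i.e., (UAV)_{ij} = 0 in K for all i ∈ S and j ∈ T. -/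
open Matrix MvPolynomial

noncomputable section

section Pencil

variable {F ι n : Type*} [Field F] [Fintype ι] [Fintype n]

/-- The specialization `A₀ + ∑ k, x k • b k (c k)ᵀ` at the point `x`. -/
def pencil (A₀ : Matrix n n F) (b c : ι → n → F) (x : ι → F) : Matrix n n F :=
  A₀ + ∑ k, x k • vecMulVec (b k) (c k)

lemma pencil_mulVec (A₀ : Matrix n n F) (b c : ι → n → F) (x : ι → F) (v : n → F) :
    pencil A₀ b c x *ᵥ v = A₀ *ᵥ v + ∑ k, (x k * (c k ⬝ᵥ v)) • b k := by
  simp only [pencil, add_mulVec, sum_mulVec, smul_mulVec, vecMulVec_mulVec]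
  congr 1
  refine Finset.sum_congr rfl fun k _ => ?_
  ext i
  simp
  ring

lemma pencil_add_single_mulVec [DecidableEq ι] (A₀ : Matrix n n F) (b c : ι → n → F) (x : ι → F)
    (k : ι) (β : F) (v : n → F) :
    pencil A₀ b c (x + Pi.single k β) *ᵥ v =
      pencil A₀ b c x *ᵥ v + (β * (c k ⬝ᵥ v)) • b k := by
  simp only [pencil_mulVec, Pi.add_apply, add_mul, add_smul, Finset.sum_add_distrib, add_assoc]
  congr 2
  rw [Finset.sum_eq_single k]
  · simp
  · intro j _ hj
    simp [hj]
  · simp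

/-- If `b k` is not in the range and `c k` does not annihilate the kernel, then a perturbation
in the direction `k` shrinks the kernel. -/
lemma finrank_ker_pencil_add_single_lt [DecidableEq ι] {A₀ : Matrix n n F} {b c : ι → n → F}
    {x : ι → F} {k : ι} (hb : ∀ u, pencil A₀ b c x *ᵥ u ≠ b k)
    {v : n → F} (hv : pencil A₀ b c x *ᵥ v = 0) (hc : c k ⬝ᵥ v ≠ 0) :
    Module.finrank F (LinearMap.ker (pencil A₀ b c (x + Pi.single k 1)).mulVecLin) <
      Module.finrank F (LinearMap.ker (pencil A₀ b c x).mulVecLin) := by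
  refine Submodule.finrank_lt_finrank_of_lt (SetLike.lt_iff_le_and_exists.2 ⟨?_, v, ?_, ?_⟩)
  · intro w hw
    rw [LinearMap.mem_ker, mulVecLin_apply, pencil_add_single_mulVec, one_mul] at hw
    by_cases h : c k ⬝ᵥ w = 0
    · simpa [h] using hw
    · refine absurd ?_ (hb (-(c k ⬝ᵥ w)⁻¹ • w))
      rw [mulVec_smul, eq_neg_of_add_eq_zero_left hw, smul_neg, neg_smul, neg_neg, smul_smul,
        inv_mul_cancel₀ h, one_smul]
  · simpa using hv
  · rw [LinearMap.mem_ker, mulVecLin_apply, pencil_add_single_mulVec, hv, zero_add, one_mul]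
    refine smul_ne_zero hc fun h => hb 0 ?_
    rw [h, mulVec_zero]

/-- If `b k = M u` for the value `M` of the pencil at `x`, then a suitable perturbation in the
direction `k` does not enlarge the kernel, and replaces its elements `v` by
`v - γ (c k ⬝ᵥ v) u`. -/
lemma pencil_add_single_of_mulVec_eq [DecidableEq ι] {A₀ : Matrix n n F} {b c : ι → n → F}
    {x : ι → F} {k : ι} {u : n → F} (hu : pencil A₀ b c x *ᵥ u = b k) {γ : F}
    (hγ : 1 - γ * (c k ⬝ᵥ u) ≠ 0) :
    ∃ y, Module.finrank F (LinearMap.ker (pencil A₀ b c y).mulVecLin) ≤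
        Module.finrank F (LinearMap.ker (pencil A₀ b c x).mulVecLin) ∧
      ∀ v, pencil A₀ b c x *ᵥ v = 0 →
        pencil A₀ b c y *ᵥ (v - (γ * (c k ⬝ᵥ v)) • u) = 0 := by
  set β := γ / (1 - γ * (c k ⬝ᵥ u)) with hβ
  have hβγ : β * (1 - γ * (c k ⬝ᵥ u)) = γ := div_mul_cancel₀ _ hγ
  refine ⟨x + Pi.single k β, ?_, fun v hv => ?_⟩
  · let T : (n → F) →ₗ[F] (n → F) :=
      LinearMap.id + β • (vecMulVec u (c k)).mulVecLin
    have hT : ∀ v, T v = v + (β * (c k ⬝ᵥ v)) • u := by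
      intro v
      ext i
      simp [T, vecMulVec_mulVec]
      ring
    have hTinj : Function.Injective T := by
      rw [← LinearMap.ker_eq_bot, LinearMap.ker_eq_bot']
      intro v hv
      rw [hT] at hv
      have h1 : (c k ⬝ᵥ v) * (1 + β * (c k ⬝ᵥ u)) = 0 := by
        have := congrArg (c k ⬝ᵥ ·) hv
        simp only [dotProduct_add, dotProduct_smul, smul_eq_mul, dotProduct_zero] at this
        linear_combination this
      have h2 : (1 + β * (c k ⬝ᵥ u)) * (1 - γ * (c k ⬝ᵥ u)) = 1 := by
        linear_combination (c k ⬝ᵥ u) * hβγ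
      have h3 : c k ⬝ᵥ v = 0 := by
        linear_combination (1 - γ * (c k ⬝ᵥ u)) * h1 - (c k ⬝ᵥ v) * h2
      simpa [h3] using hv
    have hmap : (LinearMap.ker (pencil A₀ b c (x + Pi.single k β)).mulVecLin).map T ≤
        LinearMap.ker (pencil A₀ b c x).mulVecLin := by
      rintro _ ⟨v, hv, rfl⟩
      rw [SetLike.mem_coe, LinearMap.mem_ker, mulVecLin_apply, pencil_add_single_mulVec] at hv
      rw [LinearMap.mem_ker, mulVecLin_apply, hT, mulVec_add, mulVec_smul, hu, hv]
    rw [(Submodule.equivMapOfInjective T hTinj _).finrank_eq]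
    exact Submodule.finrank_mono hmap
  · rw [pencil_add_single_mulVec, mulVec_sub, mulVec_smul, hv, hu, zero_sub, ← neg_smul,
      ← add_smul, dotProduct_sub, dotProduct_smul, smul_eq_mul]
    convert zero_smul F (b k) using 2
    linear_combination (c k ⬝ᵥ v) * hβγ

/-- There is a point at which every `b k` whose `c k` does not annihilate the kernel has a
preimage annihilated by all `c j` that annihilate the kernel. -/
lemma exists_pencil_forall_exists_preimage [Infinite F] (A₀ : Matrix n n F) (b c : ι → n → F) :
    ∃ x, ∀ k, (∃ v, pencil A₀ b c x *ᵥ v = 0 ∧ c k ⬝ᵥ v ≠ 0) →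
      ∃ u, pencil A₀ b c x *ᵥ u = b k ∧
        ∀ j, (∀ v, pencil A₀ b c x *ᵥ v = 0 → c j ⬝ᵥ v = 0) → c j ⬝ᵥ u = 0 := by
  classical
  let Z : (ι → F) → Finset ι := fun x =>
    Finset.univ.filter fun j => ∀ v, pencil A₀ b c x *ᵥ v = 0 → c j ⬝ᵥ v = 0
  let d : (ι → F) → ℕ := fun x =>
    Module.finrank F (LinearMap.ker (pencil A₀ b c x).mulVecLin)
  obtain ⟨x, hx⟩ : ∃ x, ∀ y, toLex (d x, (Z x).card) ≤ toLex (d y, (Z y).card) := by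
    obtain ⟨_, ⟨x, rfl⟩, hmin⟩ := (wellFounded_lt (α := ℕ ×ₗ ℕ)).has_min
      (Set.range fun x => toLex (d x, (Z x).card)) (Set.range_nonempty _)
    exact ⟨x, fun y => not_lt.1 (hmin _ ⟨y, rfl⟩)⟩
  simp only [Prod.Lex.toLex_le_toLex] at hx
  refine ⟨x, fun k ⟨v₀, hv₀, hkv₀⟩ => ?_⟩
  obtain ⟨u, hu⟩ : ∃ u, pencil A₀ b c x *ᵥ u = b k := by
    by_contra! h
    have h1 := finrank_ker_pencil_add_single_lt h hv₀ hkv₀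
    rcases hx (x + Pi.single k 1) with h2 | h2
    · exact lt_asymm h1 h2
    · exact h1.ne h2.1.symm
  refine ⟨u, hu, fun j hj => ?_⟩
  by_contra hju
  have hex : ∀ i, ∃ v, pencil A₀ b c x *ᵥ v = 0 ∧ (i ∉ Z x → c i ⬝ᵥ v ≠ 0) := by
    intro i
    by_cases hi : i ∈ Z x
    · exact ⟨0, by simp, fun h => absurd hi h⟩
    · simp only [Z, Finset.mem_filter, Finset.mem_univ, true_and, not_forall] at hi
      obtain ⟨v, hv, hiv⟩ := hi
      exact ⟨v, hv, fun _ => hiv⟩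
  choose w hw hiw using hex
  obtain ⟨γ, hγ⟩ := Infinite.exists_notMem_finset
    (insert 0 (insert (c k ⬝ᵥ u)⁻¹
      (Finset.univ.image fun i => (c i ⬝ᵥ w i) / ((c k ⬝ᵥ w i) * (c i ⬝ᵥ u)))))
  simp only [Finset.mem_insert, Finset.mem_image, Finset.mem_univ, true_and, not_or,
    not_exists] at hγ
  obtain ⟨hγ0, hγk, hγw⟩ := hγ
  have hγ1 : 1 - γ * (c k ⬝ᵥ u) ≠ 0 := fun h =>
    hγk (eq_inv_of_mul_eq_one_left (sub_eq_zero.1 h).symm)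
  obtain ⟨y, hdy, hy⟩ := pencil_add_single_of_mulVec_eq hu hγ1
  have hZ : Z y ⊂ Z x := by
    refine (Finset.ssubset_iff_of_subset fun i hi => ?_).2 ⟨j, by simpa [Z] using hj, fun hi => ?_⟩
    · by_contra hix
      have h1 := (Finset.mem_filter.1 hi).2 _ (hy _ (hw i))
      rw [dotProduct_sub, dotProduct_smul, smul_eq_mul, mul_assoc] at h1
      have h2 : (c k ⬝ᵥ w i) * (c i ⬝ᵥ u) ≠ 0 := by
        intro h
        rw [h, mul_zero, sub_zero] at h1
        exact hiw i hix h1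
      exact hγw i ((div_eq_iff h2).2 (sub_eq_zero.1 h1))
    · have h1 := (Finset.mem_filter.1 hi).2 _ (hy _ hv₀)
      rw [dotProduct_sub, hj _ hv₀, zero_sub, neg_eq_zero, dotProduct_smul, smul_eq_mul] at h1
      exact mul_ne_zero (mul_ne_zero hγ0 hkv₀) hju h1
  rcases hx y with h | h
  · exact absurd hdy (not_le.2 h)
  · exact absurd h.2 (not_le.2 (Finset.card_lt_card hZ))

/-- There are a point `x` and subspaces `P`, `W` orthogonal with respect to every member of the
pencil, whose dimensions add up to `n` plus the dimension of the kernel at `x`. -/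
lemma exists_pencil_orthogonal_submodules [Infinite F] (A₀ : Matrix n n F) (b c : ι → n → F) :
    ∃ (x : ι → F) (P W : Submodule F (n → F)),
      Fintype.card n + Module.finrank F (LinearMap.ker (pencil A₀ b c x).mulVecLin) ≤
        Module.finrank F P + Module.finrank F W ∧
      ∀ p ∈ P, ∀ w ∈ W, p ⬝ᵥ (pencil A₀ b c x *ᵥ w) = 0 ∧
        ∀ k, (p ⬝ᵥ b k) * (c k ⬝ᵥ w) = 0 := by
  classical
  obtain ⟨x, hx⟩ := exists_pencil_forall_exists_preimage A₀ b c
  set M := pencil A₀ b c x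
  let J : Set ι := {k | ∃ v, M *ᵥ v = 0 ∧ c k ⬝ᵥ v ≠ 0}
  let V : Submodule F (n → F) := Submodule.span F (b '' J)
  let W : Submodule F (n → F) := V.comap M.mulVecLin
  let e := dotProductEquiv F n
  let P : Submodule F (n → F) := V.dualAnnihilator.comap e.toLinearMap
  have hP : ∀ p ∈ P, ∀ v ∈ V, p ⬝ᵥ v = 0 := fun p hp v hv =>
    (Submodule.mem_dualAnnihilator _).1 hp v hv
  have hVrange : V ≤ LinearMap.range M.mulVecLin := by
    rw [Submodule.span_le]
    rintro _ ⟨k, hk, rfl⟩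
    obtain ⟨u, hu, -⟩ := hx k hk
    exact ⟨u, hu⟩
  refine ⟨x, P, W, ?_, fun p hp w hw => ⟨hP p hp _ hw, fun k => ?_⟩⟩
  · have hPdim : Module.finrank F P = Module.finrank F V.dualAnnihilator :=
      (e.submoduleMap P).finrank_eq.trans (by
        rw [show P.map (e : (n → F) →ₗ[F] _) = V.dualAnnihilator from
          Submodule.map_comap_eq_of_surjective e.surjective _])
    have h1 := Subspace.finrank_add_finrank_dualAnnihilator_eq V
    have hker : LinearMap.ker M.mulVecLin ≤ W := fun v hv => by
      change M.mulVecLin v ∈ V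
      rw [LinearMap.mem_ker.1 hv]
      exact V.zero_mem
    have h2 := LinearMap.finrank_range_add_finrank_ker (M.mulVecLin.domRestrict W)
    have h3 : LinearMap.range (M.mulVecLin.domRestrict W) = V := by
      rw [LinearMap.range_domRestrict, Submodule.map_comap_eq, inf_eq_right]
      exact hVrange
    have h4 : Module.finrank F (LinearMap.ker (M.mulVecLin.domRestrict W)) =
        Module.finrank F (LinearMap.ker M.mulVecLin) := by
      rw [LinearMap.ker_domRestrict]
      exact (Submodule.comapSubtypeEquivOfLe hker).finrank_eq
    rw [h3, h4] at h2
    change _ + Module.finrank F (LinearMap.ker M.mulVecLin) ≤ _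
    rw [Module.finrank_fintype_fun_eq_card] at h1
    omega
  · by_cases hk : k ∈ J
    · rw [hP p hp _ (Submodule.subset_span ⟨k, hk, rfl⟩), zero_mul]
    · have hk' : ∀ v, M *ᵥ v = 0 → c k ⬝ᵥ v = 0 := by
        intro v hv
        by_contra h
        exact hk ⟨v, hv, h⟩
      have hV : V ≤ (LinearMap.ker (e (c k))).map M.mulVecLin := by
        rw [Submodule.span_le]
        rintro _ ⟨l, hl, rfl⟩
        obtain ⟨u, hu, hju⟩ := hx l hl
        exact ⟨u, hju k hk', hu⟩
      obtain ⟨w', hw', hww'⟩ := hV hw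
      have h0 : c k ⬝ᵥ w' = 0 := hw'
      have h1 : M *ᵥ w' = M *ᵥ w := hww'
      have h2 := hk' (w - w') (by rw [mulVec_sub, h1, sub_self])
      rw [dotProduct_sub, h0, sub_zero] at h2
      rw [h2, mul_zero]

end Pencil

/-- A basis of a subspace extends to an invertible matrix. -/
lemma exists_det_ne_zero_rows_mem {F n : Type*} [Field F] [Fintype n] [DecidableEq n]
    (P : Submodule F (n → F)) :
    ∃ (U : Matrix n n F) (S : Finset n), U.det ≠ 0 ∧ S.card = Module.finrank F P ∧
      ∀ i ∈ S, U i ∈ P := by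
  obtain ⟨Q, hPQ⟩ := Submodule.exists_isCompl P
  let B := ((Module.finBasis F P).prod (Module.finBasis F Q)).map
    (Submodule.prodEquivOfIsCompl P Q hPQ)
  let e := B.indexEquiv (Pi.basisFun F n)
  let B' := B.reindex e
  refine ⟨Matrix.of B', Finset.univ.map (Function.Embedding.inl.trans e.toEmbedding), ?_, ?_, ?_⟩
  · have h : IsUnit (Matrix.of B') :=
      Matrix.linearIndependent_rows_iff_isUnit.1 B'.linearIndependent
    exact ((Matrix.isUnit_iff_isUnit_det _).1 h).ne_zero
  · simp
  · intro i hi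
    obtain ⟨a, -, rfl⟩ := Finset.mem_map.1 hi
    change B' (e (Sum.inl a)) ∈ P
    simp [B', B]

/-- A matrix of rank `r` can be compressed to the identity matrix of size `r`. -/
lemma exists_mul_mul_eq_one {F n : Type*} [Field F] [Fintype n] [DecidableEq n]
    (M : Matrix n n F) :
    ∃ (X : Matrix (Fin M.rank) n F) (Y : Matrix n (Fin M.rank) F), X * M * Y = 1 := by
  let e : (Fin M.rank → F) ≃ₗ[F] LinearMap.range M.mulVecLin :=
    LinearEquiv.ofFinrankEq _ _ (by rw [Module.finrank_fin_fun, Matrix.rank])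
  obtain ⟨g, hg⟩ := M.mulVecLin.rangeRestrict.exists_rightInverse_of_surjective
    M.mulVecLin.range_rangeRestrict
  let f : (Fin M.rank → F) →ₗ[F] (n → F) := g ∘ₗ e.toLinearMap
  have hMf : ∀ v, M.mulVecLin (f v) = e v := fun v =>
    congrArg Subtype.val (LinearMap.congr_fun hg (e v))
  have hinj : LinearMap.ker (M.mulVecLin ∘ₗ f) = ⊥ := by
    rw [LinearMap.ker_eq_bot]
    intro v w hvw
    refine e.injective (Subtype.ext ?_)
    rw [← hMf, ← hMf]
    exact hvw
  obtain ⟨h, hh⟩ := LinearMap.exists_leftInverse_of_injective _ hinj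
  refine ⟨LinearMap.toMatrix' h, LinearMap.toMatrix' f, ?_⟩
  rw [← LinearMap.toMatrix'_id, ← hh, LinearMap.toMatrix'_comp, LinearMap.toMatrix'_comp,
    ← Matrix.toLin'_apply', LinearMap.toMatrix'_toLin', Matrix.mul_assoc]

lemma rank_pencil_le_rank_oneCM {n m : ℕ} (A₀ : Matrix (Fin n) (Fin n) ℝ)
    (b c : Fin m → Fin n → ℝ) (x : Fin m → ℝ) :
    (pencil A₀ b c x).rank ≤ (oneCM n m A₀ b c).rank := by
  obtain ⟨X, Y, hXY⟩ := exists_mul_mul_eq_one (pencil A₀ b c x)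
  let A : Matrix (Fin n) (Fin n) (MvPolynomial (Fin m) ℝ) :=
    A₀.map C + ∑ k, (MvPolynomial.X k : MvPolynomial (Fin m) ℝ) •
      (vecMulVec (b k) (c k)).map C
  let ψ := algebraMap (MvPolynomial (Fin m) ℝ) (Kf m)
  have hA : A.map ψ = oneCM n m A₀ b c := by
    ext i j
    simp [A, ψ, oneCM, φ, α, Matrix.sum_apply]
    simp only [Algebra.smul_def]
  have hev : A.map (MvPolynomial.eval x) = pencil A₀ b c x := by
    ext i j
    simp [A, pencil, Matrix.sum_apply]
  let κ : ℝ →+* MvPolynomial (Fin m) ℝ := C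
  have hdet : (X.map κ * A * Y.map κ).det ≠ 0 := by
    intro h
    have h1 := congrArg (MvPolynomial.eval x) h
    rw [RingHom.map_det, RingHom.mapMatrix_apply, Matrix.map_mul, Matrix.map_mul, hev,
      Matrix.map_map, Matrix.map_map] at h1
    simp [κ, Function.comp_def, hXY] at h1
  have hdet' : (X.map (φ m) * oneCM n m A₀ b c * Y.map (φ m)).det ≠ 0 := by
    have h := (map_ne_zero_iff ψ (IsFractionRing.injective _ _)).2 hdet
    rw [RingHom.map_det, RingHom.mapMatrix_apply, Matrix.map_mul, Matrix.map_mul, hA,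
      Matrix.map_map, Matrix.map_map] at h
    exact h
  have hrank := Matrix.rank_of_isUnit _ ((Matrix.isUnit_iff_isUnit_det _).2 hdet'.isUnit)
  rw [Fintype.card_fin] at hrank
  calc (pencil A₀ b c x).rank
      = (X.map (φ m) * oneCM n m A₀ b c * Y.map (φ m)).rank := hrank.symm
    _ ≤ (X.map (φ m) * oneCM n m A₀ b c).rank := Matrix.rank_mul_le_left _ _
    _ ≤ _ := Matrix.rank_mul_le_right _ _

lemma oneCM_eq_pencil_add {n m : ℕ} (A₀ : Matrix (Fin n) (Fin n) ℝ)
    (b c : Fin m → Fin n → ℝ) (x : Fin m → ℝ) :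
    oneCM n m A₀ b c = (pencil A₀ b c x).map (φ m) +
      ∑ k, (α m k - φ m (x k)) • (vecMulVec (b k) (c k)).map (φ m) := by
  ext i j
  simp [oneCM, pencil, Matrix.sum_apply, sub_mul, map_sum]

/-- If a 1CM-matrix has rank `r < n`, then there exist nonsingular real matrices `U, V` and
subsets `S, T ⊆ [n]` with `|S| + |T| ≥ 2n − r` such that the submatrix of `UAV` with rows `S`
and columns `T` is identically zero. -/
theorem stmt_4 (n m r : ℕ) (A₀ : Matrix (Fin n) (Fin n) ℝ) (b c : Fin m → Fin n → ℝ)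
    (hrank : (oneCM n m A₀ b c).rank = r) (hr : r < n) :
    ∃ (U V : Matrix (Fin n) (Fin n) ℝ) (S T : Finset (Fin n)),
      U.det ≠ 0 ∧ V.det ≠ 0 ∧ S.card + T.card ≥ 2 * n - r ∧
      ∀ i ∈ S, ∀ j ∈ T, (U.map (φ m) * oneCM n m A₀ b c * V.map (φ m)) i j = 0 := by
  obtain ⟨x, P, W, hdim, horth⟩ := exists_pencil_orthogonal_submodules A₀ b c
  obtain ⟨U, S, hU, hS, hSP⟩ := exists_det_ne_zero_rows_mem P
  obtain ⟨V, T, hV, hT, hTW⟩ := exists_det_ne_zero_rows_mem W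
  refine ⟨U, Vᵀ, S, T, hU, by rwa [det_transpose], ?_, fun i hi j hj => ?_⟩
  · have h1 := rank_pencil_le_rank_oneCM A₀ b c x
    have h2 := LinearMap.finrank_range_add_finrank_ker (pencil A₀ b c x).mulVecLin
    rw [Module.finrank_fintype_fun_eq_card, Fintype.card_fin] at h2
    rw [Fintype.card_fin] at hdim
    rw [hrank, Matrix.rank] at h1
    omega
  · obtain ⟨h1, h2⟩ := horth _ (hSP i hi) _ (hTW j hj)
    have h3 : (U * pencil A₀ b c x * Vᵀ) i j = 0 := by
      rw [Matrix.mul_assoc, ← h1]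
      rfl
    have h4 : ∀ k, (U * vecMulVec (b k) (c k) * Vᵀ) i j = 0 := by
      intro k
      rw [mul_vecMulVec, vecMulVec_mul, vecMulVec_apply, vecMul_transpose, ← h2 k,
        dotProduct_comm (c k)]
      rfl
    rw [oneCM_eq_pencil_add A₀ b c x, Matrix.mul_add, Matrix.add_mul, Matrix.mul_sum,
      Matrix.sum_mul, Matrix.add_apply, Matrix.sum_apply]
    simp only [Matrix.mul_smul, Matrix.smul_mul, ← Matrix.map_mul, Matrix.smul_apply,
      Matrix.map_apply, h3, h4, map_zero, smul_zero, Finset.sum_const_zero, add_zero]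

end
end

section
/- Let A = A₀ + α₁ b₁c₁ᵀ + ⋯ + α_m b_m c_mᵀ be an n×n 1CM-matrix that is singular (det A = 0 in K), and let p, q ∈ ℤⁿ be arbitrary integer vectors. Then there exists a vanishing pair (U, V) of A such that U is upper-triangular along p and V is upper-triangular along q. -/
open Matrix MvPolynomial

noncomputable section

/-- A matrix `M` is upper-triangular along `p` if `M i j = 0` whenever `p i > p j`. -/
def UpperTriAlong {n : ℕ} {R : Type*} [Zero R] (p : Fin n → ℤ)
    (M : Matrix (Fin n) (Fin n) R) : Prop :=
  ∀ i j, p i > p j → M i j = 0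

section

open Module

theorem finrank_comap_le {V W : Type} [AddCommGroup V] [Module ℝ V] [FiniteDimensional ℝ V]
    [AddCommGroup W] [Module ℝ W] [FiniteDimensional ℝ W] (f : V →ₗ[ℝ] W) (Z : Submodule ℝ W) :
    finrank ℝ (Z.comap f) ≤ finrank ℝ Z + finrank ℝ (LinearMap.ker f) := by
  rw [← LinearMap.finrank_range_add_finrank_ker (f.domRestrict (Z.comap f))]
  gcongr
  · apply Submodule.finrank_mono
    rintro _ ⟨⟨x, hx⟩, rfl⟩
    exact hx
  · refine LinearMap.finrank_le_finrank_of_injective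
      (f := ((Z.comap f).subtype ∘ₗ Submodule.subtype _).codRestrict (LinearMap.ker f) ?_) ?_
    · rintro ⟨⟨x, hx⟩, h⟩
      exact h
    · intro x y h
      exact Subtype.ext (Subtype.ext (congrArg (fun z : LinearMap.ker f => (z : V)) h))

theorem finrank_map_add_one_le {V W : Type} [AddCommGroup V] [Module ℝ V] [FiniteDimensional ℝ V]
    [AddCommGroup W] [Module ℝ W] (f : V →ₗ[ℝ] W) (S : Submodule ℝ V) {v : V} (hv : v ∈ S)
    (hv0 : v ≠ 0) (hfv : f v = 0) :
    finrank ℝ (S.map f) + 1 ≤ finrank ℝ S := by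
  rw [← LinearMap.finrank_range_add_finrank_ker (f.domRestrict S), LinearMap.range_domRestrict]
  gcongr
  have : Nontrivial (LinearMap.ker (f.domRestrict S)) :=
    ⟨⟨⟨⟨v, hv⟩, hfv⟩, 0, fun h => hv0 (congrArg (fun x => (x.1 : V)) h)⟩⟩
  exact finrank_pos

/-- Lower semicontinuity of the rank along a line, for the Zariski topology. -/
theorem exists_polynomial_finrank_range_le {V W : Type} [AddCommGroup V] [Module ℝ V]
    [FiniteDimensional ℝ V] [AddCommGroup W] [Module ℝ W] [FiniteDimensional ℝ W]
    (f h : V →ₗ[ℝ] W) (s₀ : ℝ) :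
    ∃ P : Polynomial ℝ, P.eval s₀ ≠ 0 ∧ ∀ s, P.eval s ≠ 0 →
      finrank ℝ (LinearMap.range (f + s₀ • h)) ≤ finrank ℝ (LinearMap.range (f + s • h)) := by
  set g := f + s₀ • h with hg
  obtain ⟨j, hj⟩ := g.rangeRestrict.exists_rightInverse_of_surjective g.range_rangeRestrict
  obtain ⟨p, hp⟩ := (LinearMap.range g).subtype.exists_leftInverse_of_injective
    (Submodule.ker_subtype _)
  have hpg : p ∘ₗ g ∘ₗ j = LinearMap.id := by
    ext1 x
    have h1 : g (j x) = x := congrArg Subtype.val (LinearMap.congr_fun hj x)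
    have h2 : p x = x := LinearMap.congr_fun hp x
    simp [h1, h2]
  let B := finBasis ℝ (LinearMap.range g)
  let F := LinearMap.toMatrix B B (p ∘ₗ f ∘ₗ j)
  let H := LinearMap.toMatrix B B (p ∘ₗ h ∘ₗ j)
  have heval (s : ℝ) : ((F.map Polynomial.C + (Polynomial.X : Polynomial ℝ) •
      H.map Polynomial.C).det).eval s = LinearMap.det (p ∘ₗ (f + s • h) ∘ₗ j) := by
    rw [← Polynomial.coe_evalRingHom, RingHom.map_det, ← LinearMap.det_toMatrix B]
    congr 1
    ext a b
    simp [F, H, LinearMap.toMatrix_apply, mul_comm s]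
  refine ⟨(F.map Polynomial.C + (Polynomial.X : Polynomial ℝ) • H.map Polynomial.C).det,
    ?_, fun s hs => ?_⟩
  · rw [heval, ← hg, hpg, LinearMap.det_id]
    exact one_ne_zero
  · rw [heval] at hs
    have hinj : Function.Injective (p ∘ₗ (f + s • h) ∘ₗ j) :=
      (LinearMap.equivOfDetNeZero _ hs).injective
    refine LinearMap.finrank_le_finrank_of_injective (f := (f + s • h).rangeRestrict ∘ₗ j) ?_
    intro x y hxy
    exact hinj (congrArg p (congrArg Subtype.val hxy))

theorem exists_add_one_le_finrank_range {V W : Type} [AddCommGroup V] [Module ℝ V]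
    [FiniteDimensional ℝ V] [AddCommGroup W] [Module ℝ W] [FiniteDimensional ℝ W]
    (N : V →ₗ[ℝ] W) {b : W} {c : Dual ℝ V} (hb : b ≠ 0) (hc : c ≠ 0) {ρ : ℕ}
    (hρb : ρ ≤ finrank ℝ (LinearMap.range ((ℝ ∙ b).mkQ ∘ₗ N)))
    (hρc : ρ ≤ finrank ℝ (LinearMap.range (N ∘ₗ (LinearMap.ker c).subtype))) :
    ∃ s : ℝ, ρ + 1 ≤ finrank ℝ (LinearMap.range (N + s • c.smulRight b)) := by
  have hle : LinearMap.range (N ∘ₗ (LinearMap.ker c).subtype) ≤ LinearMap.range N :=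
    LinearMap.range_comp_le_range _ _
  rcases hle.lt_or_eq with hlt | heq
  · refine ⟨0, ?_⟩
    rw [zero_smul, add_zero]
    exact hρc.trans_lt (Submodule.finrank_lt_finrank_of_lt hlt)
  · obtain ⟨v, hv⟩ : ∃ v, c v ≠ 0 := by
      by_contra! h
      exact hc (LinearMap.ext h)
    obtain ⟨⟨u, hu⟩, huv⟩ : N v ∈ LinearMap.range (N ∘ₗ (LinearMap.ker c).subtype) :=
      heq ▸ LinearMap.mem_range_self N v
    have hu : c u = 0 := hu
    have huv : N u = N v := huv
    have hbmem : b ∈ LinearMap.range (N + (1 : ℝ) • c.smulRight b) :=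
      ⟨(c v)⁻¹ • (v - u), by simp [hu, huv, hv]⟩
    have hq : (ℝ ∙ b).mkQ b = 0 := by simp
    refine ⟨1, le_trans ?_ (finrank_map_add_one_le (ℝ ∙ b).mkQ _ hbmem hb hq)⟩
    rw [← LinearMap.range_comp]
    have : (ℝ ∙ b).mkQ ∘ₗ (N + (1 : ℝ) • c.smulRight b) = (ℝ ∙ b).mkQ ∘ₗ N := by
      ext x
      simp only [LinearMap.comp_apply, LinearMap.add_apply, LinearMap.smul_apply, map_add,
        LinearMap.smulRight_apply, map_smul, hq, smul_zero, add_zero]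
    rw [this]
    omega

/-- The map `A + ∑ tₖ bₖ cₖ`, where `bₖ` are vectors and `cₖ` are linear forms. -/
def rankOnePencil {V W : Type} [AddCommGroup V] [Module ℝ V] [AddCommGroup W] [Module ℝ W]
    {m : ℕ} (A : V →ₗ[ℝ] W) (b : Fin m → W) (c : Fin m → Dual ℝ V) (t : Fin m → ℝ) :
    V →ₗ[ℝ] W :=
  A + ∑ k, t k • (c k).smulRight (b k)

theorem rankOnePencil_succ {V W : Type} [AddCommGroup V] [Module ℝ V] [AddCommGroup W]
    [Module ℝ W] {m : ℕ} (A : V →ₗ[ℝ] W) (b : Fin (m + 1) → W) (c : Fin (m + 1) → Dual ℝ V)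
    (s : ℝ) (t : Fin m → ℝ) :
    rankOnePencil A b c (Fin.cons s t) =
      rankOnePencil A (Fin.tail b) (Fin.tail c) t + s • (c 0).smulRight (b 0) := by
  simp only [rankOnePencil, Fin.sum_univ_succ, Fin.cons_zero, Fin.cons_succ, Fin.tail]
  abel

theorem rankOnePencil_line {V W : Type} [AddCommGroup V] [Module ℝ V] [AddCommGroup W]
    [Module ℝ W] {m : ℕ} (A : V →ₗ[ℝ] W) (b : Fin m → W) (c : Fin m → Dual ℝ V)
    (t t' : Fin m → ℝ) (s : ℝ) :
    rankOnePencil A b c (t + s • t') = rankOnePencil A b c t +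
      s • rankOnePencil 0 b c t' := by
  simp only [rankOnePencil, Pi.add_apply, Pi.smul_apply, smul_eq_mul, add_smul, mul_smul,
    Finset.sum_add_distrib, Finset.smul_sum, zero_add, add_assoc]

theorem comp_rankOnePencil {V V' W W' : Type} [AddCommGroup V] [Module ℝ V] [AddCommGroup W]
    [Module ℝ W] [AddCommGroup V'] [Module ℝ V'] [AddCommGroup W'] [Module ℝ W']
    {m : ℕ} (A : V →ₗ[ℝ] W) (b : Fin m → W) (c : Fin m → Dual ℝ V) (t : Fin m → ℝ)
    (f : W →ₗ[ℝ] W') (g : V' →ₗ[ℝ] V) :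
    f ∘ₗ rankOnePencil A b c t ∘ₗ g =
      rankOnePencil (f ∘ₗ A ∘ₗ g) (fun k => f (b k)) (fun k => (c k) ∘ₗ g) t := by
  ext x
  simp [rankOnePencil, LinearMap.sum_apply]

/-- Rank lower bounds attained by two pencils in the same parameters are attained
simultaneously. -/
theorem exists_le_finrank_rankOnePencil {V W V' W' : Type} [AddCommGroup V] [Module ℝ V]
    [FiniteDimensional ℝ V] [AddCommGroup W] [Module ℝ W] [FiniteDimensional ℝ W]
    [AddCommGroup V'] [Module ℝ V'] [FiniteDimensional ℝ V'] [AddCommGroup W'] [Module ℝ W']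
    [FiniteDimensional ℝ W'] {m : ℕ} (A : V →ₗ[ℝ] W) (b : Fin m → W) (c : Fin m → Dual ℝ V)
    (A' : V' →ₗ[ℝ] W') (b' : Fin m → W') (c' : Fin m → Dual ℝ V') {t₀ t₁ : Fin m → ℝ} :
    ∃ t, finrank ℝ (LinearMap.range (rankOnePencil A b c t₀)) ≤
        finrank ℝ (LinearMap.range (rankOnePencil A b c t)) ∧
      finrank ℝ (LinearMap.range (rankOnePencil A' b' c' t₁)) ≤
        finrank ℝ (LinearMap.range (rankOnePencil A' b' c' t)) := by
  obtain ⟨P, hP, hP'⟩ := exists_polynomial_finrank_range_le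
    (rankOnePencil A b c t₀) (rankOnePencil 0 b c (t₁ - t₀)) 0
  obtain ⟨Q, hQ, hQ'⟩ := exists_polynomial_finrank_range_le
    (rankOnePencil A' b' c' t₀) (rankOnePencil 0 b' c' (t₁ - t₀)) 1
  have hPQ : P * Q ≠ 0 := by
    apply mul_ne_zero <;> rintro rfl <;> simp_all
  obtain ⟨s, hs⟩ : ∃ s, (P * Q).eval s ≠ 0 := by
    by_contra! h
    exact hPQ (Polynomial.funext (by simpa using h))
  rw [Polynomial.eval_mul] at hs
  have h1 := hP' s (left_ne_zero_of_mul hs)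
  have h2 := hQ' s (right_ne_zero_of_mul hs)
  rw [zero_smul, add_zero, ← rankOnePencil_line] at h1
  rw [← rankOnePencil_line, ← rankOnePencil_line, one_smul, add_sub_cancel] at h2
  exact ⟨_, h1, h2⟩

/-- If every member of a rank-one pencil has rank less than `r`, then this is witnessed by a
pair of subspaces. -/
theorem exists_submodules_of_finrank_rankOnePencil_lt {m : ℕ} :
    ∀ {V W : Type} [AddCommGroup V] [Module ℝ V] [FiniteDimensional ℝ V] [AddCommGroup W]
    [Module ℝ W] [FiniteDimensional ℝ W] (A : V →ₗ[ℝ] W) (b : Fin m → W) (c : Fin m → Dual ℝ V)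
    (r : ℕ), (∀ t, finrank ℝ (LinearMap.range (rankOnePencil A b c t)) < r) →
    ∃ (Y : Submodule ℝ V) (Z : Submodule ℝ W), (∀ y ∈ Y, A y ∈ Z) ∧
      (∀ k, b k ∈ Z ∨ ∀ y ∈ Y, c k y = 0) ∧
      finrank ℝ V + finrank ℝ Z < r + finrank ℝ Y := by
  induction m with
  | zero =>
    intro V W _ _ _ _ _ _ A b c r h
    refine ⟨⊤, LinearMap.range A, fun y _ => ⟨y, rfl⟩, fun k => k.elim0, ?_⟩
    have := h 0
    rw [rankOnePencil, Finset.univ_eq_empty, Finset.sum_empty, add_zero] at this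
    rw [finrank_top]
    omega
  | succ m ih =>
    intro V W _ _ _ _ _ _ A b c r h
    simp only [Fin.forall_fin_succ]
    by_cases hbc : b 0 = 0 ∨ c 0 = 0
    · obtain ⟨Y, Z, hA, hk, hd⟩ := ih A (Fin.tail b) (Fin.tail c) r fun t => by
        have h0 := h (Fin.cons 0 t)
        rwa [rankOnePencil_succ, zero_smul, add_zero] at h0
      refine ⟨Y, Z, hA, ⟨?_, hk⟩, hd⟩
      rcases hbc with h0 | h0 <;> simp [h0]
    push Not at hbc
    obtain ⟨hb, hc⟩ := hbc
    obtain ⟨r, rfl⟩ : ∃ r', r = r' + 1 := Nat.exists_eq_succ_of_ne_zero (h 0).ne_bot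
    have hB (t : Fin m → ℝ) := comp_rankOnePencil A (Fin.tail b) (Fin.tail c) t
      (ℝ ∙ b 0).mkQ LinearMap.id
    have hC (t : Fin m → ℝ) := comp_rankOnePencil A (Fin.tail b) (Fin.tail c) t
      LinearMap.id (LinearMap.ker (c 0)).subtype
    simp only [LinearMap.comp_id, LinearMap.id_comp] at hB hC
    by_cases h1 : ∀ t : Fin m → ℝ, finrank ℝ (LinearMap.range
        ((ℝ ∙ b 0).mkQ ∘ₗ rankOnePencil A (Fin.tail b) (Fin.tail c) t)) < r
    · obtain ⟨Y, Z, hA, hk, hd⟩ := ih _ _ _ r fun t => hB t ▸ h1 t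
      refine ⟨Y, Z.comap (ℝ ∙ b 0).mkQ, hA, ⟨Or.inl ?_, hk⟩, ?_⟩
      · rw [Submodule.mem_comap, Submodule.mkQ_apply,
          (Submodule.Quotient.mk_eq_zero _).mpr (Submodule.mem_span_singleton_self _)]
        exact Z.zero_mem
      · have h2 := finrank_comap_le (ℝ ∙ b 0).mkQ Z
        rw [Submodule.ker_mkQ, finrank_span_singleton hb] at h2
        omega
    by_cases h2 : ∀ t : Fin m → ℝ, finrank ℝ (LinearMap.range
        (rankOnePencil A (Fin.tail b) (Fin.tail c) t ∘ₗ (LinearMap.ker (c 0)).subtype)) < r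
    · obtain ⟨Y, Z, hA, hk, hd⟩ := ih _ _ _ r fun t => hC t ▸ h2 t
      refine ⟨Y.map (LinearMap.ker (c 0)).subtype, Z, ?_, ⟨Or.inr ?_, fun k => ?_⟩, ?_⟩
      · rintro _ ⟨y, hy, rfl⟩
        exact hA y hy
      · rintro _ ⟨y, hy, rfl⟩
        exact y.2
      · refine (hk k).imp_right ?_
        rintro h _ ⟨y, hy, rfl⟩
        exact h y hy
      · have h3 := Module.Dual.finrank_ker_add_one_of_ne_zero hc
        rw [Submodule.finrank_map_subtype_eq]
        omega
    push Not at h1 h2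
    obtain ⟨t₀, h1⟩ := h1
    obtain ⟨t₁, h2⟩ := h2
    rw [hB] at h1
    rw [hC] at h2
    obtain ⟨t, h3, h4⟩ := exists_le_finrank_rankOnePencil
      ((ℝ ∙ b 0).mkQ ∘ₗ A) (fun k => (ℝ ∙ b 0).mkQ (Fin.tail b k)) (Fin.tail c)
      (A ∘ₗ (LinearMap.ker (c 0)).subtype) (Fin.tail b)
      (fun k => Fin.tail c k ∘ₗ (LinearMap.ker (c 0)).subtype) (t₀ := t₀) (t₁ := t₁)
    have h5 := h1.trans h3
    have h6 := h2.trans h4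
    replace h5 := hB t ▸ h5
    replace h6 := hC t ▸ h6
    obtain ⟨s, hs⟩ := exists_add_one_le_finrank_range _ hb hc h5 h6
    rw [← rankOnePencil_succ] at hs
    exact absurd (h _) hs.not_gt

/-- A subspace has many vectors in some basis of `ℝⁿ` adapted to the flag given by `p`. -/
theorem exists_upperTriAlong_rows_mem {n : ℕ} (p : Fin n → ℤ) (X : Submodule ℝ (Fin n → ℝ)) :
    ∃ (U : Matrix (Fin n) (Fin n) ℝ) (I : Finset (Fin n)), U.det ≠ 0 ∧ UpperTriAlong p U ∧
      finrank ℝ X ≤ I.card ∧ ∀ i ∈ I, U i ∈ X := by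
  classical
  let f : Fin n → ℤ ×ₗ Fin n := fun i => toLex (p i, i)
  have hf : Function.Injective f := fun i j h => (Prod.ext_iff.mp (toLex.injective h)).2
  have hfp {i j : Fin n} (h : p j < p i) : f j < f i := Prod.Lex.toLex_lt_toLex.mpr (Or.inl h)
  let I : Finset (Fin n) := {i | ∃ x ∈ X, x i ≠ 0 ∧ ∀ j, f j < f i → x j = 0}
  have hU (i : Fin n) : ∃ u : Fin n → ℝ, u i ≠ 0 ∧ (∀ j, f j < f i → u j = 0) ∧
      (i ∈ I → u ∈ X) := by
    by_cases hi : i ∈ I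
    · obtain ⟨x, hx, h1, h2⟩ := (Finset.mem_filter.mp hi).2
      exact ⟨x, h1, h2, fun _ => hx⟩
    · refine ⟨Pi.single i 1, by simp, fun j hj => ?_, fun h => absurd h hi⟩
      exact Pi.single_eq_of_ne (fun h => hj.ne (congrArg f h)) _
  choose U hdiag htri hmem using hU
  refine ⟨Matrix.of U, I, fun hdet => ?_, fun i j hij => htri i j (hfp hij), ?_, hmem⟩
  · obtain ⟨x, hx, hUx⟩ := Matrix.exists_mulVec_eq_zero_iff.mpr hdet
    obtain ⟨i₀, hi₀⟩ := Function.ne_iff.mp hx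
    obtain ⟨i, hi, hmax⟩ := Finset.exists_max_image {i | x i ≠ 0} f ⟨i₀, by simpa using hi₀⟩
    have h1 := congrFun hUx i
    rw [Matrix.mulVec, dotProduct, Finset.sum_eq_single i] at h1
    · exact mul_ne_zero (hdiag i) (by simpa using hi) h1
    · intro j _ hji
      rcases lt_or_gt_of_ne (hf.ne hji) with h | h
      · simp [htri i j h]
      · by_cases hj : x j = 0
        · simp [hj]
        · exact absurd (hmax j (by simpa using hj)) h.not_ge
    · simp
  · let g : X →ₗ[ℝ] (I → ℝ) := (LinearMap.funLeft ℝ ℝ (Subtype.val : I → Fin n)) ∘ₗ X.subtype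
    have hg : Function.Injective g := by
      rw [injective_iff_map_eq_zero]
      rintro ⟨x, hxX⟩ hx
      by_contra hne
      obtain ⟨i₀, hi₀⟩ := Function.ne_iff.mp fun h : x = 0 => hne (Subtype.ext h)
      obtain ⟨i, hi, hmin⟩ := Finset.exists_min_image {i | x i ≠ 0} f ⟨i₀, by simpa using hi₀⟩
      have hxi : x i ≠ 0 := by simpa using hi
      have hiI : i ∈ I := by
        refine Finset.mem_filter.mpr ⟨Finset.mem_univ _, x, hxX, hxi, fun j hj => ?_⟩
        by_contra hxj
        exact absurd (hmin j (by simpa using hxj)) hj.not_ge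
      exact hxi (congrFun hx ⟨i, hiI⟩)
    simpa using LinearMap.finrank_le_finrank_of_injective hg

theorem det_eq_zero_of_det_oneCM_eq_zero {n m : ℕ} {A₀ : Matrix (Fin n) (Fin n) ℝ}
    {b c : Fin m → Fin n → ℝ} (hsing : (oneCM n m A₀ b c).det = 0) (t : Fin m → ℝ) :
    (A₀ + ∑ k, t k • vecMulVec (b k) (c k)).det = 0 := by
  let P : Matrix (Fin n) (Fin n) (MvPolynomial (Fin m) ℝ) :=
    A₀.map C + ∑ k, (X k : MvPolynomial (Fin m) ℝ) • (vecMulVec (b k) (c k)).map C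
  have h1 : oneCM n m A₀ b c = P.map (algebraMap _ (Kf m)) := by
    ext i j
    simp only [oneCM, P, Matrix.sum_apply, φ, α, Matrix.add_apply, Matrix.smul_apply,
      Matrix.map_apply, smul_eq_mul, map_add, map_sum, map_mul, RingHom.comp_apply]
  have h2 : P.det = 0 := by
    rw [h1, ← RingHom.mapMatrix_apply, ← RingHom.map_det] at hsing
    exact (map_eq_zero_iff _ (IsFractionRing.injective _ _)).mp hsing
  have h3 : A₀ + ∑ k, t k • vecMulVec (b k) (c k) = P.map (MvPolynomial.eval t) := by
    ext i j
    simp [P, Matrix.sum_apply]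
  rw [h3, ← RingHom.mapMatrix_apply, ← RingHom.map_det, h2, map_zero]

theorem mul_oneCM_mul_apply {n m : ℕ} (A₀ : Matrix (Fin n) (Fin n) ℝ)
    (b c : Fin m → Fin n → ℝ) (U V : Matrix (Fin n) (Fin n) ℝ) (i j : Fin n) :
    (U.map (φ m) * oneCM n m A₀ b c * V.map (φ m)) i j =
      φ m (U i ⬝ᵥ A₀ *ᵥ V.col j) +
        ∑ k, α m k * φ m ((U i ⬝ᵥ b k) * (c k ⬝ᵥ V.col j)) := by
  have h : U.map (φ m) * oneCM n m A₀ b c * V.map (φ m) = (U * A₀ * V).map (φ m) +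
      ∑ k, α m k • (U * vecMulVec (b k) (c k) * V).map (φ m) := by
    simp [oneCM, Matrix.mul_add, Matrix.add_mul, Matrix.mul_sum, Matrix.sum_mul, Matrix.map_mul]
  have h1 : (U * A₀ * V) i j = U i ⬝ᵥ A₀ *ᵥ V.col j := by
    rw [Matrix.mul_assoc]
    rfl
  have h2 (k : Fin m) : (U * vecMulVec (b k) (c k) * V) i j =
      (U i ⬝ᵥ b k) * (c k ⬝ᵥ V.col j) := by
    rw [Matrix.mul_vecMulVec, Matrix.vecMulVec_mul]
    rfl
  simp only [h, Matrix.add_apply, Matrix.sum_apply, Matrix.smul_apply, Matrix.map_apply, h1, h2,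
    smul_eq_mul]

end

/-- A singular 1CM-matrix admits a vanishing pair `(U, V)` with `U` upper-triangular along `p`
and `V` upper-triangular along `q`, for any integer vectors `p, q`. -/
theorem stmt_5 (n m : ℕ) (A₀ : Matrix (Fin n) (Fin n) ℝ) (b c : Fin m → Fin n → ℝ)
    (p q : Fin n → ℤ) (hsing : (oneCM n m A₀ b c).det = 0) :
    ∃ U V : Matrix (Fin n) (Fin n) ℝ, U.det ≠ 0 ∧ V.det ≠ 0 ∧
      UpperTriAlong p U ∧ UpperTriAlong q V ∧
      ∀ σ : Equiv.Perm (Fin n),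
        ∃ i : Fin n, (U.map (φ m) * oneCM n m A₀ b c * V.map (φ m)) i (σ i) = 0 := by
  obtain ⟨Y, Z, hA, hk, hd⟩ := exists_submodules_of_finrank_rankOnePencil_lt A₀.mulVecLin b
    (fun k => dotProductEquiv ℝ (Fin n) (c k)) n fun t => by
      obtain ⟨v, hv, hv0⟩ :=
        Matrix.exists_mulVec_eq_zero_iff.mpr (det_eq_zero_of_det_oneCM_eq_zero hsing t)
      have h := finrank_map_add_one_le (rankOnePencil A₀.mulVecLin b
        (fun k => dotProductEquiv ℝ (Fin n) (c k)) t) ⊤ Submodule.mem_top hv (by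
          rw [← hv0]
          simp [rankOnePencil, Matrix.add_mulVec, Matrix.sum_mulVec, LinearMap.sum_apply,
            Matrix.smul_mulVec, Matrix.vecMulVec_mulVec])
      rwa [Submodule.map_top, finrank_top, Module.finrank_fin_fun, Nat.succ_le_iff] at h
  let X : Submodule ℝ (Fin n → ℝ) :=
    Z.dualAnnihilator.map (dotProductEquiv ℝ (Fin n)).symm.toLinearMap
  have hX : ∀ x ∈ X, ∀ z ∈ Z, x ⬝ᵥ z = 0 := by
    rintro _ ⟨f, hf, rfl⟩ z hz
    have := (Submodule.mem_dualAnnihilator f).mp hf z hz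
    rwa [← (dotProductEquiv ℝ (Fin n)).apply_symm_apply f] at this
  have hXZ : Module.finrank ℝ Z + Module.finrank ℝ X = n := by
    have := Subspace.finrank_add_finrank_dualAnnihilator_eq Z
    rw [LinearEquiv.finrank_map_eq]
    simpa using this
  obtain ⟨U, I, hU, hUp, hI, hIX⟩ := exists_upperTriAlong_rows_mem p X
  obtain ⟨V, J, hV, hVq, hJ, hJY⟩ := exists_upperTriAlong_rows_mem (-q) Y
  refine ⟨U, Vᵀ, hU, by rwa [Matrix.det_transpose], hUp, fun i j hij => hVq j i ?_, fun σ => ?_⟩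
  · simpa using hij
  obtain ⟨i, hi, hσi⟩ : ∃ i ∈ I, σ i ∈ J := by
    by_contra! h
    have hdisj : Disjoint (I.map σ.toEmbedding) J := by
      rw [Finset.disjoint_left]
      intro j hj
      obtain ⟨i, hi, rfl⟩ := Finset.mem_map.mp hj
      exact h i hi
    have hcard := Finset.card_le_univ ((I.map σ.toEmbedding).disjUnion J hdisj)
    rw [Finset.card_disjUnion, Finset.card_map, Fintype.card_fin] at hcard
    simp only [Module.finrank_fin_fun] at hd
    omega
  refine ⟨i, ?_⟩
  have hcol : Vᵀ.col (σ i) = V (σ i) := rfl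
  have hUAV : U i ⬝ᵥ A₀ *ᵥ V (σ i) = 0 := hX _ (hIX i hi) _ (hA _ (hJY _ hσi))
  rw [mul_oneCM_mul_apply, hcol, hUAV, map_zero, zero_add]
  refine Finset.sum_eq_zero fun k _ => ?_
  rcases hk k with h | h
  · simp [hX _ (hIX i hi) _ h]
  · have h0 : c k ⬝ᵥ V (σ i) = 0 := h _ (hJY _ hσi)
    simp [h0]

end
end

section
/- Let A(s) be an n×n matrix over the polynomial ring F[s] over a field F and let p, q ∈ ℤⁿ be degree-feasible for A(s). Let J be the tight coefficient matrix of A(s) with respect to (p,q), and set δ = Σ_{j=1}^n q_j − Σ_{i=1}^n p_i. If δ ≥ 0, then the coefficient of s^δ in det A(s) equals det J; consequently, deg det A(s) = δ if and only if det J ≠ 0. -/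
open Matrix Polynomial

noncomputable section

/-- The degree of a polynomial, viewed in `ℤ ∪ {−∞}` (`WithBot ℤ`). -/
def degZ {F : Type*} [Semiring F] (f : Polynomial F) : WithBot ℤ :=
  f.degree.map (Nat.cast : ℕ → ℤ)

/-- The tight coefficient matrix of a polynomial matrix `A(s)` with respect to `(p, q)`:
its `(i,j)` entry is the coefficient of `s^{q_j − p_i}` in `A(s)_{ij}` if `q_j − p_i ≥ 0`,
and `0` otherwise. -/
def tightCoeff {F : Type*} [Semiring F] (n : ℕ) (A : Matrix (Fin n) (Fin n) (Polynomial F))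
    (p q : Fin n → ℤ) : Matrix (Fin n) (Fin n) F :=
  Matrix.of fun i j => if 0 ≤ q j - p i then (A i j).coeff (q j - p i).toNat else 0

theorem degZ_le_iff_coeff_eq_zero {F : Type*} [Semiring F] (f : Polynomial F) (k : ℤ) :
    degZ f ≤ (k : WithBot ℤ) ↔ ∀ m : ℕ, k < m → f.coeff m = 0 := by
  unfold degZ
  by_cases hf : f = 0
  · simp [hf]
  · rw [degree_eq_natDegree hf]
    change ((f.natDegree : ℤ) : WithBot ℤ) ≤ k ↔ _
    rw [WithBot.coe_le_coe]
    constructor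
    · intro h m hm
      exact coeff_eq_zero_of_natDegree_lt (by omega)
    · intro h
      by_contra! hk
      exact hf (leadingCoeff_eq_zero.mp (h _ hk))

theorem degZ_eq_iff_coeff_ne_zero {F : Type*} [Semiring F] {f : Polynomial F} {k : ℤ}
    (hk : 0 ≤ k) (hf : degZ f ≤ (k : WithBot ℤ)) :
    degZ f = (k : WithBot ℤ) ↔ f.coeff k.toNat ≠ 0 := by
  have h := degZ_le_iff_coeff_eq_zero f (k - 1)
  have hlt : degZ f ≤ ((k - 1 : ℤ) : WithBot ℤ) ↔ degZ f < (k : WithBot ℤ) := by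
    cases degZ f with
    | bot => simp
    | coe a => simp only [WithBot.coe_le_coe, WithBot.coe_lt_coe]; omega
  rw [hlt] at h
  rw [← not_iff_not, not_not, ← ne_eq, ← (lt_iff_le_and_ne.trans (and_iff_right hf)), h]
  constructor
  · intro h
    exact h _ (by omega)
  · intro h m hm
    rcases eq_or_ne m k.toNat with rfl | hne
    · exact h
    · exact (degZ_le_iff_coeff_eq_zero f k).mp hf m (by omega)

/-- The coefficient of a polynomial at an integer exponent, which is `0` at negative exponents. -/
def intCoeff {F : Type*} [Semiring F] (f : Polynomial F) (k : ℤ) : F :=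
  if 0 ≤ k then f.coeff k.toNat else 0

theorem eq_zero_of_degZ_le_of_neg {F : Type*} [Semiring F] {f : Polynomial F} {k : ℤ}
    (hf : degZ f ≤ (k : WithBot ℤ)) (hk : k < 0) : f = 0 := by
  ext m
  exact (degZ_le_iff_coeff_eq_zero f k).mp hf m (by omega)

theorem natDegree_le_toNat_of_degZ_le {F : Type*} [Semiring F] {f : Polynomial F} {k : ℤ}
    (hf : degZ f ≤ (k : WithBot ℤ)) : f.natDegree ≤ k.toNat :=
  natDegree_le_iff_coeff_eq_zero.mpr fun m hm =>
    (degZ_le_iff_coeff_eq_zero f k).mp hf m (by omega)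

theorem degZ_mul_le_and_intCoeff_mul {F : Type*} [Semiring F] {f g : Polynomial F} {a b : ℤ}
    (hf : degZ f ≤ (a : WithBot ℤ)) (hg : degZ g ≤ (b : WithBot ℤ)) :
    degZ (f * g) ≤ ((a + b : ℤ) : WithBot ℤ) ∧
      intCoeff (f * g) (a + b) = intCoeff f a * intCoeff g b := by
  rcases lt_or_ge a 0 with ha | ha
  · simp [eq_zero_of_degZ_le_of_neg hf ha, intCoeff, degZ]
  rcases lt_or_ge b 0 with hb | hb
  · simp [eq_zero_of_degZ_le_of_neg hg hb, intCoeff, degZ]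
  have hf' := natDegree_le_toNat_of_degZ_le hf
  have hg' := natDegree_le_toNat_of_degZ_le hg
  refine ⟨(degZ_le_iff_coeff_eq_zero _ _).mpr fun m hm => ?_, ?_⟩
  · have := natDegree_mul_le (p := f) (q := g)
    exact coeff_eq_zero_of_natDegree_lt (by omega)
  · rw [intCoeff, intCoeff, intCoeff, if_pos ha, if_pos hb, if_pos (add_nonneg ha hb),
      Int.toNat_add ha hb, coeff_mul_add_eq_of_natDegree_le hf' hg']

theorem degZ_prod_le_and_intCoeff_prod {F ι : Type*} [CommSemiring F] (s : Finset ι)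
    (f : ι → Polynomial F) (d : ι → ℤ) (h : ∀ i, degZ (f i) ≤ (d i : WithBot ℤ)) :
    degZ (∏ i ∈ s, f i) ≤ ((∑ i ∈ s, d i : ℤ) : WithBot ℤ) ∧
      intCoeff (∏ i ∈ s, f i) (∑ i ∈ s, d i) = ∏ i ∈ s, intCoeff (f i) (d i) := by
  classical
  induction s using Finset.induction_on with
  | empty =>
    refine ⟨(degZ_le_iff_coeff_eq_zero _ _).mpr fun m hm => ?_, by simp [intCoeff]⟩
    simp only [Finset.sum_empty, Nat.cast_pos] at hm
    simp [coeff_one, hm.ne']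
  | insert i s hi ih =>
    rw [Finset.prod_insert hi, Finset.sum_insert hi, Finset.prod_insert hi, ← ih.2]
    exact degZ_mul_le_and_intCoeff_mul (h i) ih.1

/-- If `(p,q)` is degree-feasible for `A(s)` and `δ = Σ_j q_j − Σ_i p_i ≥ 0`, then the
coefficient of `s^δ` in `det A(s)` equals `det J` where `J` is the tight coefficient matrix;
consequently, `deg det A(s) = δ` iff `det J ≠ 0`. -/
theorem stmt_9 {F : Type*} [Field F] (n : ℕ) (A : Matrix (Fin n) (Fin n) (Polynomial F))
    (p q : Fin n → ℤ) (hfeas : ∀ i j, degZ (A i j) ≤ ((q j - p i : ℤ) : WithBot ℤ))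
    (δ : ℤ) (hδdef : δ = (∑ j, q j) - ∑ i, p i) (hδ : 0 ≤ δ) :
    A.det.coeff δ.toNat = (tightCoeff n A p q).det ∧
    (degZ A.det = (δ : WithBot ℤ) ↔ (tightCoeff n A p q).det ≠ 0) := by
  have hσ (σ : Equiv.Perm (Fin n)) : ∑ i, (q i - p (σ i)) = δ := by
    rw [Finset.sum_sub_distrib, Equiv.sum_comp σ p, hδdef]
  have hprod (σ : Equiv.Perm (Fin n)) := degZ_prod_le_and_intCoeff_prod Finset.univ
    (fun i => A (σ i) i) (fun i => q i - p (σ i)) fun i => hfeas (σ i) i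
  simp only [hσ] at hprod
  have hcoeff : A.det.coeff δ.toNat = (tightCoeff n A p q).det := by
    simp only [det_apply, finsetSum_coeff, coeff_smul]
    refine Finset.sum_congr rfl fun σ _ => congrArg _ ?_
    have := (hprod σ).2
    rw [intCoeff, if_pos hδ] at this
    exact this
  have hdeg : degZ A.det ≤ (δ : WithBot ℤ) := by
    rw [degZ_le_iff_coeff_eq_zero]
    intro m hm
    simp only [det_apply, finsetSum_coeff, coeff_smul]
    refine Finset.sum_eq_zero fun σ _ => ?_
    rw [(degZ_le_iff_coeff_eq_zero _ _).mp (hprod σ).1 m hm, smul_zero]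
  exact ⟨hcoeff, hcoeff ▸ degZ_eq_iff_coeff_ne_zero hδ hdeg⟩

end
end

section
/- Let w : {1,…,n}×{1,…,n} → ℤ ∪ {−∞} be a weight function, and suppose there exists a permutation σ₀ of {1,…,n} with w(i, σ₀(i)) ≠ −∞ for all i. Call a pair (p,q) of vectors p, q ∈ ℤ≥0ⁿ feasible if q_j − p_i ≥ w(i,j) for all i, j with w(i,j) ≠ −∞. If (p,q) is feasible and minimizes Σ_{j=1}^n q_j − Σ_{i=1}^n p_i among all feasible pairs, then there exists a permutation τ of {1,…,n} such that q_{τ(i)} − p_i = w(i, τ(i)) for every i; in particular, the tight entries {(i,j) : w(i,j) ≠ −∞ and q_j − p_i = w(i,j)} contain a perfect matching. -/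
noncomputable section

/-- `(p, q)` is a feasible dual solution for the assignment problem with weights
`w : [n]×[n] → ℤ ∪ {−∞}`: `q_j − p_i ≥ w(i,j)` for every pair with finite weight. -/
def DualFeasible {n : ℕ} (w : Fin n → Fin n → WithBot ℤ) (p q : Fin n → ℕ) : Prop :=
  ∀ i j, w i j ≠ ⊥ → w i j ≤ (((q j : ℤ) - (p i : ℤ) : ℤ) : WithBot ℤ)

/-- Raising `p` by one on a set `S` of rows and `q` by one on a set of columns containing all the
tight neighbours of `S` preserves dual feasibility. -/
theorem DualFeasible.add_indicator {n : ℕ} {w : Fin n → Fin n → WithBot ℤ} {p q : Fin n → ℕ}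
    (h : DualFeasible w p q) (S N : Finset (Fin n))
    (hN : ∀ i ∈ S, ∀ j, w i j = (((q j : ℤ) - (p i : ℤ) : ℤ) : WithBot ℤ) → j ∈ N) :
    DualFeasible w (fun i => p i + if i ∈ S then 1 else 0)
      (fun j => q j + if j ∈ N then 1 else 0) := by
  intro i j hij
  have hle := h i j hij
  have htight := fun hi => hN i hi j
  lift w i j to ℤ using hij with a
  rw [WithBot.coe_le_coe] at hle ⊢
  rw [WithBot.coe_inj] at htight
  by_cases hi : i ∈ S <;> by_cases hj : j ∈ N <;> simp only [hi, hj, if_true, if_false]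
  · push_cast; omega
  · have hne : a ≠ (q j : ℤ) - p i := fun e => hj (htight hi e)
    push_cast; omega
  · push_cast; omega
  · push_cast; omega

/-- Complementary slackness for the dual of the maximum-weight perfect bipartite matching
problem: if some perfect matching uses only finite-weight entries and `(p,q)` is an optimal
feasible dual solution, then there is a permutation `τ` with `q_{τ(i)} − p_i = w(i, τ(i))`
for every `i`. -/
theorem stmt_10 (n : ℕ) (w : Fin n → Fin n → WithBot ℤ)
    (σ₀ : Equiv.Perm (Fin n)) (hσ₀ : ∀ i, w i (σ₀ i) ≠ ⊥)
    (p q : Fin n → ℕ) (hfeas : DualFeasible w p q)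
    (hopt : ∀ p' q' : Fin n → ℕ, DualFeasible w p' q' →
      (∑ j, (q j : ℤ)) - ∑ i, (p i : ℤ) ≤ (∑ j, (q' j : ℤ)) - ∑ i, (p' i : ℤ)) :
    ∃ τ : Equiv.Perm (Fin n),
      ∀ i, w i (τ i) = (((q (τ i) : ℤ) - (p i : ℤ) : ℤ) : WithBot ℤ) := by
  classical
  obtain ⟨f, hf, hw⟩ := (Fintype.all_card_le_filter_rel_iff_exists_injective
    (fun i j => w i j = (((q j : ℤ) - (p i : ℤ) : ℤ) : WithBot ℤ))).1 (by
      intro S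
      have hcard : ∀ N : Finset (Fin n),
          (∀ i ∈ S, ∀ j, w i j = (((q j : ℤ) - (p i : ℤ) : ℤ) : WithBot ℤ) → j ∈ N) →
          S.card ≤ N.card := by
        intro N hN
        have hle := hopt _ _ (hfeas.add_indicator S N hN)
        push_cast at hle
        simp only [Finset.sum_add_distrib, Finset.sum_ite_mem, Finset.univ_inter,
          Finset.sum_const, nsmul_eq_mul, mul_one] at hle
        omega
      refine hcard _ (fun i hi j hij => ?_)
      simpa using ⟨i, hi, hij⟩)
  exact ⟨Equiv.ofBijective f (Finite.injective_iff_bijective.1 hf), hw⟩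

end
end

section
/- Let a, b ∈ ℝⁿ, p, q ∈ ℤⁿ, and l ∈ ℤ, and suppose that for all indices i, j, if b_i·a_j ≠ 0 then q_j − p_i ≥ l. Define the real n×n matrix A by A_{ij} = b_i·a_j if q_j − p_i = l, and A_{ij} = 0 otherwise. Then rank A ≤ 1. -/
open Matrix

noncomputable section

/-- Let `a, b ∈ ℝⁿ`, `p, q ∈ ℤⁿ`, `l ∈ ℤ`, and suppose `q_j − p_i ≥ l` whenever
`b_i·a_j ≠ 0`. Then the matrix `A` with `A_{ij} = b_i·a_j` when `q_j − p_i = l` and `0`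
otherwise has rank at most 1. -/
theorem stmt_11 (n : ℕ) (a b : Fin n → ℝ) (p q : Fin n → ℤ) (l : ℤ)
    (h : ∀ i j, b i * a j ≠ 0 → q j - p i ≥ l) :
    (Matrix.of fun i j => if q j - p i = l then b i * a j else 0 :
      Matrix (Fin n) (Fin n) ℝ).rank ≤ 1 := by
  by_cases hne : ∃ i j, q j - p i = l ∧ b i ≠ 0 ∧ a j ≠ 0
  · obtain ⟨i₀, j₀, hl, hb, ha⟩ := hne
    convert Matrix.rank_vecMulVec_le (fun i => if p i = p i₀ then b i else 0)
      (fun j => if q j = q j₀ then a j else 0) using 2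
    ext i j
    simp only [Matrix.of_apply, Matrix.vecMulVec_apply]
    by_cases hbi : b i = 0
    · simp [hbi]
    by_cases haj : a j = 0
    · simp [haj]
    have h₁ := h i j₀ (mul_ne_zero hbi ha)
    have h₂ := h i₀ j (mul_ne_zero hb haj)
    split_ifs <;> first | omega | simp
  · push Not at hne
    convert Nat.zero_le 1
    rw [← Matrix.rank_zero (m := Fin n) (n := Fin n) (R := ℝ)]
    congr 1
    ext i j
    simp only [Matrix.of_apply, Matrix.zero_apply, ite_eq_right_iff, mul_eq_zero]
    intro hl
    by_cases hb : b i = 0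
    · exact Or.inl hb
    · exact Or.inr (hne i j hl hb)

end
end
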